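/- arXiv:1001.2756 — 4 statements merged into one kernel-verified Lean document; each statement's English description precedes it below -/
import Mathlib

section
/- Let Q₀(x,y,z) = 2xz − y² on ℝ³. For every c > 0, k ∈ ℕ and every sufficiently small τ > 0 there exist C > 0 and T₀ ≥ 2 such that the following holds for all T ≥ T₀: if g ∈ GL₃(ℚ) is a matrix whose entries are rational numbers with numerators and denominators bounded in absolute value by T^{kτ}, with |det g| ≤ T^τ, and such that every nonzero vector of the lattice Δ = gℤ³ has Euclidean norm at least c, then #{w ∈ 𝒫(Δ) : Q₀(w) = 0 and ‖w‖ ≤ T} ≤ C·T. -/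
open Matrix

noncomputable section

def eNorm {n : ℕ} (x : Fin n → ℝ) : ℝ := Real.sqrt (∑ i, x i ^ 2)

def intCast {n : ℕ} (x : Fin n → ℤ) : Fin n → ℝ := fun i => (x i : ℝ)

/-- The standard split form `Q₀(x,y,z) = 2xz - y²` of signature `(2,1)`. -/
def Q0 (v : Fin 3 → ℝ) : ℝ := 2 * v 0 * v 2 - v 1 ^ 2

/-- A primitive integer vector. -/
def PrimVec {n : ℕ} (m : Fin n → ℤ) : Prop :=
  m ≠ 0 ∧ ∀ d : ℤ, (∀ i, d ∣ m i) → IsUnit d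

theorem exists_intCast_mulVec_mem_ball (A : Matrix (Fin 3) (Fin 3) ℝ) (hA : A.det ≠ 0) {r : ℝ}
    (hr : 0 < r) (h : |A.det| < r ^ 3) :
    ∃ m : Fin 3 → ℤ, m ≠ 0 ∧ A *ᵥ intCast m ∈ Metric.ball (0 : Fin 3 → ℝ) r := by
  have hdet : LinearMap.det (Matrix.toLin' A) ≠ 0 := by rwa [LinearMap.det_toLin']
  have fund := ZSpan.isAddFundamentalDomain' (Pi.basisFun ℝ (Fin 3)) MeasureTheory.volume
  have : Countable (Submodule.span ℤ (Set.range (Pi.basisFun ℝ (Fin 3)))).toAddSubgroup :=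
    inferInstanceAs (Countable (Submodule.span ℤ (Set.range (Pi.basisFun ℝ (Fin 3)))))
  have key : MeasureTheory.volume (ZSpan.fundamentalDomain (Pi.basisFun ℝ (Fin 3))) *
      2 ^ Module.finrank ℝ (Fin 3 → ℝ) <
      MeasureTheory.volume (Matrix.toLin' A ⁻¹' Metric.ball (0 : Fin 3 → ℝ) r) := by
    rw [MeasureTheory.Measure.addHaar_preimage_linearMap _ hdet, Real.volume_pi_ball _ hr,
      LinearMap.det_toLin', ZSpan.volume_fundamentalDomain, ← ENNReal.ofReal_mul (abs_nonneg _)]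
    have h1 : (Matrix.of (Pi.basisFun ℝ (Fin 3))).det = 1 := by
      have : Matrix.of (Pi.basisFun ℝ (Fin 3)) = (1 : Matrix (Fin 3) (Fin 3) ℝ) := by
        ext i j
        simp [Matrix.one_apply, Pi.single_apply, eq_comm]
      rw [this, Matrix.det_one]
    have h2 : (2 : ENNReal) ^ 3 = ENNReal.ofReal (2 ^ 3) := by
      rw [ENNReal.ofReal_pow (by norm_num)]
      simp
    rw [h1, Module.finrank_fin_fun, h2, abs_one, ENNReal.ofReal_one, one_mul,
      ENNReal.ofReal_lt_ofReal_iff_of_nonneg (by norm_num), Fintype.card_fin, abs_inv, mul_pow,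
      inv_mul_eq_div, lt_div_iff₀ (abs_pos.mpr hA)]
    exact mul_lt_mul_of_pos_left h (by norm_num)
  obtain ⟨x, hx0, hx⟩ :=
    MeasureTheory.exists_ne_zero_mem_lattice_of_measure_mul_two_pow_lt_measure fund
      (fun x hx => by simpa [Matrix.mulVec_neg] using hx)
      ((convex_ball (0 : Fin 3 → ℝ) r).linear_preimage (Matrix.toLin' A)) key
  have hmem : (x : Fin 3 → ℝ) ∈ Submodule.span ℤ (Set.range (Pi.basisFun ℝ (Fin 3))) := x.2
  rw [Module.Basis.mem_span_iff_repr_mem] at hmem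
  choose m hm using hmem
  have hmx : intCast m = x := by
    funext i
    simpa [intCast] using hm i
  refine ⟨m, ?_, ?_⟩
  · rintro rfl
    apply hx0
    ext i
    rw [← hmx]
    simp [intCast]
  · rw [hmx]
    simpa using hx

theorem le_abs_det_of_le_eNorm (A : Matrix (Fin 3) (Fin 3) ℝ) (hA : A.det ≠ 0) {c : ℝ}
    (hc : 0 < c) (h : ∀ m : Fin 3 → ℤ, m ≠ 0 → c ≤ eNorm (A *ᵥ intCast m)) :
    (c / 2) ^ 3 ≤ |A.det| := by
  by_contra! hlt
  obtain ⟨m, hm0, hm⟩ := exists_intCast_mulVec_mem_ball A hA (half_pos hc) hlt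
  have hle := h m hm0
  rw [mem_ball_zero_iff, pi_norm_lt_iff (half_pos hc)] at hm
  have hsq : ∀ i, (A *ᵥ intCast m) i ^ 2 < (c / 2) ^ 2 := fun i =>
    sq_lt_sq' (abs_lt.mp (hm i)).1 (abs_lt.mp (hm i)).2
  rw [eNorm, Real.le_sqrt' hc, Fin.sum_univ_three] at hle
  nlinarith [hsq 0, hsq 1, hsq 2]

theorem abs_le_eNorm {n : ℕ} (x : Fin n → ℝ) (i : Fin n) : |x i| ≤ eNorm x :=
  Real.abs_le_sqrt (Finset.single_le_sum (f := fun i => x i ^ 2)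
    (fun j _ => sq_nonneg (x j)) (Finset.mem_univ i))

theorem PrimVec.exists_sum_mul_eq_one {n : ℕ} {m : Fin n → ℤ} (hm : PrimVec m) :
    ∃ u : Fin n → ℤ, ∑ i, u i * m i = 1 := by
  obtain ⟨d, hd⟩ := (IsPrincipalIdealRing.principal (Ideal.span (Set.range m))).principal
  have hunit : IsUnit d := hm.2 d fun i => by
    rw [← Ideal.mem_span_singleton, ← Ideal.submodule_span_eq, ← hd]
    exact Ideal.subset_span (Set.mem_range_self i)
  have h1 : (1 : ℤ) ∈ Ideal.span (Set.range m) := by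
    rw [hd, Ideal.submodule_span_eq, Ideal.span_singleton_eq_top.mpr hunit]
    trivial
  obtain ⟨u, hu⟩ := (Ideal.mem_span_range_iff_exists_fun).mp h1
  exact ⟨u, hu⟩

theorem PrimVec.eq_or_eq_neg {n : ℕ} {m m' : Fin n → ℤ} (hm : PrimVec m) (hm' : PrimVec m')
    (h : ∀ i j, m i * m' j = m j * m' i) : m = m' ∨ m = -m' := by
  obtain ⟨u, hu⟩ := hm'.exists_sum_mul_eq_one
  have he : ∀ i, m i = (∑ j, u j * m j) * m' i := fun i => by
    calc m i = m i * ∑ j, u j * m' j := by rw [hu, mul_one]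
      _ = ∑ j, u j * m j * m' i := by
        rw [Finset.mul_sum]
        refine Finset.sum_congr rfl fun j _ => ?_
        linear_combination u j * h i j
      _ = _ := (Finset.sum_mul ..).symm
  rcases Int.isUnit_iff.mp (hm.2 _ fun i => Dvd.intro _ (he i).symm) with h1 | h1
  · left
    funext i
    rw [he i, h1, one_mul]
  · right
    funext i
    rw [he i, h1, Pi.neg_apply, neg_one_mul]

theorem intCast_ne_zero {n : ℕ} {m : Fin n → ℤ} (hm : m ≠ 0) : intCast m ≠ 0 := by
  contrapose! hm
  funext i
  simpa [intCast] using congrFun hm i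

/-- If among any three points of `F` with distinct images under `s` two have images at distance
at least `h`, and the fibres of `s` have at most two points, then `F` has `O(1 / h)` points. -/
theorem card_le_of_no_three_close {α : Type*} (F : Finset α) (s : α → ℝ) {h : ℝ} (h0 : 0 < h)
    (h1 : h ≤ 1) (hs : ∀ a ∈ F, |s a| ≤ 2)
    (hfib : ∀ t : ℝ, (F.filter fun a => s a = t).card ≤ 2)
    (hsep : ∀ a ∈ F, ∀ b ∈ F, ∀ d ∈ F, s a ≠ s b → s a ≠ s d → s b ≠ s d →
      ⌊s a / h⌋ = ⌊s b / h⌋ → ⌊s a / h⌋ = ⌊s d / h⌋ → False) :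
    (F.card : ℝ) ≤ 24 / h := by
  classical
  have hcard : F.card ≤ 4 * (Finset.Icc ⌊-2 / h⌋ ⌊2 / h⌋).card := by
    refine Finset.card_le_mul_card_image_of_maps_to (f := fun a => ⌊s a / h⌋) (fun a ha => ?_) 4
      fun b _ => ?_
    · obtain ⟨h2, h3⟩ := abs_le.mp (hs a ha)
      rw [Finset.mem_Icc]
      constructor <;> gcongr
    · have hbin := Finset.card_le_mul_card_image (f := s) (F.filter fun a => ⌊s a / h⌋ = b) 2
        fun t _ => (Finset.card_le_card
          (Finset.filter_subset_filter _ (Finset.filter_subset _ _))).trans (hfib t)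
      suffices ((F.filter fun a => ⌊s a / h⌋ = b).image s).card ≤ 2 by omega
      by_contra! hlt
      obtain ⟨x, hx, y, hy, z, hz, hxy, hxz, hyz⟩ := Finset.two_lt_card.mp hlt
      simp only [Finset.mem_image, Finset.mem_filter] at hx hy hz
      obtain ⟨a₁, ⟨ha₁, hb₁⟩, rfl⟩ := hx
      obtain ⟨a₂, ⟨ha₂, hb₂⟩, rfl⟩ := hy
      obtain ⟨a₃, ⟨ha₃, hb₃⟩, rfl⟩ := hz
      exact hsep a₁ ha₁ a₂ ha₂ a₃ ha₃ hxy hxz hyz (hb₁.trans hb₂.symm) (hb₁.trans hb₃.symm)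
  have hle : ⌊-2 / h⌋ ≤ ⌊2 / h⌋ + 1 := by
    have : ⌊-2 / h⌋ ≤ ⌊2 / h⌋ := by gcongr; norm_num
    omega
  have hIcc : ((Finset.Icc ⌊-2 / h⌋ ⌊2 / h⌋).card : ℝ) ≤ 6 / h := by
    have h2 : ((Finset.Icc ⌊-2 / h⌋ ⌊2 / h⌋).card : ℝ) = ⌊2 / h⌋ + 1 - ⌊-2 / h⌋ := by
      exact_mod_cast Int.card_Icc_of_le _ _ hle
    have h3 := Int.floor_le (2 / h)
    have h4 := Int.lt_floor_add_one (-2 / h)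
    have h5 : 1 ≤ 1 / h := (one_le_div h0).mpr h1
    have h6 : 2 / h = 2 * (1 / h) := by ring
    have h7 : -2 / h = -2 * (1 / h) := by ring
    have h8 : 6 / h = 6 * (1 / h) := by ring
    linarith
  calc (F.card : ℝ) ≤ 4 * (Finset.Icc ⌊-2 / h⌋ ⌊2 / h⌋).card := by exact_mod_cast hcard
    _ ≤ 4 * (6 / h) := by gcongr
    _ = 24 / h := by ring

theorem abs_sub_lt_of_floor_div_eq {h x y : ℝ} (h0 : 0 < h) (hxy : ⌊x / h⌋ = ⌊y / h⌋) :
    |x - y| < h := by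
  have := Int.abs_sub_lt_one_of_floor_eq_floor hxy
  rwa [← sub_div, abs_div, abs_of_pos h0, div_lt_one h0] at this

/-- Three pairwise non-proportional isotropic vectors of the lattice `A ℤ³` span a parallelepiped
of volume at least the covolume; the volume is a Vandermonde determinant in the slopes. -/
theorem two_mul_abs_det_le_vandermonde (A : Matrix (Fin 3) (Fin 3) ℝ) (m : Fin 3 → Fin 3 → ℤ)
    (x s : Fin 3 → ℝ) (hx : ∀ j, x j ≠ 0)
    (h0 : ∀ j, (A *ᵥ intCast (m j)) 0 = x j) (h1 : ∀ j, (A *ᵥ intCast (m j)) 1 = x j * s j)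
    (h2 : ∀ j, (A *ᵥ intCast (m j)) 2 = x j * (s j ^ 2 / 2))
    (h01 : s 0 ≠ s 1) (h02 : s 0 ≠ s 2) (h12 : s 1 ≠ s 2) :
    2 * |A.det| ≤ |x 0 * x 1 * x 2| * (|s 0 - s 1| * |s 0 - s 2| * |s 1 - s 2|) := by
  set N : Matrix (Fin 3) (Fin 3) ℤ := Matrix.of fun i j => m j i with hN
  have hentry : ∀ i j, (A * N.map (Int.cast : ℤ → ℝ)) i j = (A *ᵥ intCast (m j)) i :=
    fun i j => rfl
  have hprod : 2 * (A.det * (N.det : ℝ)) =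
      -(x 0 * x 1 * x 2 * ((s 0 - s 1) * (s 0 - s 2) * (s 1 - s 2))) := by
    have hcast : (N.det : ℝ) = (N.map (Int.cast : ℤ → ℝ)).det :=
      (Int.castRingHom ℝ).map_det N
    rw [hcast, ← Matrix.det_mul, Matrix.det_fin_three]
    simp only [hentry, h0, h1, h2]
    ring
  have hN0 : N.det ≠ 0 := by
    intro hzero
    rw [hzero, Int.cast_zero, mul_zero, mul_zero, eq_comm, neg_eq_zero] at hprod
    exact mul_ne_zero (mul_ne_zero (mul_ne_zero (hx 0) (hx 1)) (hx 2))
      (mul_ne_zero (mul_ne_zero (sub_ne_zero.mpr h01) (sub_ne_zero.mpr h02))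
        (sub_ne_zero.mpr h12)) hprod
  have hN1 : (1 : ℝ) ≤ |(N.det : ℝ)| := by exact_mod_cast Int.one_le_abs hN0
  have habs := congrArg abs hprod
  rw [abs_neg, abs_mul 2, abs_mul A.det, abs_mul (x 0 * x 1 * x 2),
    abs_mul ((s 0 - s 1) * (s 0 - s 2)), abs_mul (s 0 - s 1), abs_two] at habs
  rw [← habs]
  nlinarith [abs_nonneg A.det]

theorem card_isotropic_le_of_abs_two_le_abs_zero (A : Matrix (Fin 3) (Fin 3) ℝ) {η T : ℝ}
    (hA : A.det ≠ 0) (hη : 0 < η) (hη1 : η ≤ 1) (hT : 1 ≤ T) (hdet : η ^ 3 ≤ |A.det|)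
    (F : Finset (Fin 3 → ℤ))
    (hF : ∀ m ∈ F, PrimVec m ∧ Q0 (A *ᵥ intCast m) = 0 ∧ |(A *ᵥ intCast m) 0| ≤ T ∧
      |(A *ᵥ intCast m) 2| ≤ |(A *ᵥ intCast m) 0|) :
    (F.card : ℝ) ≤ 24 / η * T := by
  have hT0 : 0 < T := by linarith
  set x : (Fin 3 → ℤ) → ℝ := fun m => (A *ᵥ intCast m) 0 with hxdef
  set s : (Fin 3 → ℤ) → ℝ := fun m => (A *ᵥ intCast m) 1 / x m with hsdef
  have hx : ∀ m ∈ F, x m ≠ 0 := by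
    intro m hm hx0
    obtain ⟨hp, hq, -, h2⟩ := hF m hm
    change (A *ᵥ intCast m) 0 = 0 at hx0
    rw [hx0, abs_zero, abs_nonpos_iff] at h2
    rw [Q0, hx0, h2, mul_zero, zero_sub, neg_eq_zero, sq_eq_zero_iff] at hq
    refine intCast_ne_zero hp.1 (Matrix.eq_zero_of_mulVec_eq_zero hA ?_)
    funext i
    fin_cases i
    exacts [hx0, hq, h2]
  have hw1 : ∀ m ∈ F, (A *ᵥ intCast m) 1 = x m * s m := fun m hm =>
    (mul_div_cancel₀ _ (hx m hm)).symm
  have hw2 : ∀ m ∈ F, (A *ᵥ intCast m) 2 = x m * (s m ^ 2 / 2) := by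
    intro m hm
    have hq := (hF m hm).2.1
    rw [Q0, hw1 m hm] at hq
    change 2 * x m * _ - _ = 0 at hq
    apply mul_left_cancel₀ (hx m hm)
    linear_combination hq / 2
  have hmain := card_le_of_no_three_close F s (h := η / T) (by positivity)
    ((div_le_one hT0).mpr (by linarith)) ?_ ?_ ?_
  · calc (F.card : ℝ) ≤ 24 / (η / T) := hmain
      _ = 24 / η * T := by field_simp
  · intro m hm
    have h2 := (hF m hm).2.2.2
    rw [hw2 m hm, abs_mul] at h2
    have h3 : |s m ^ 2 / 2| ≤ 1 := by
      by_contra! hlt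
      exact absurd h2 (not_le.mpr (lt_mul_of_one_lt_right (abs_pos.mpr (hx m hm)) hlt))
    exact abs_le_of_sq_le_sq (by linarith [(abs_le.mp h3).2]) (by norm_num)
  · intro t
    by_contra! hlt
    obtain ⟨a, ha, b, hb, d, hd, hab, had, hbd⟩ := Finset.two_lt_card.mp hlt
    rw [Finset.mem_filter] at ha hb hd
    have hprop : ∀ p ∈ F, ∀ q ∈ F, s p = s q → p = q ∨ p = -q := by
      intro p hp q hq hpq
      refine (hF p hp).1.eq_or_eq_neg (hF q hq).1 ?_
      have hlin : x q • intCast p - x p • intCast q = 0 := by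
        refine Matrix.eq_zero_of_mulVec_eq_zero hA ?_
        rw [Matrix.mulVec_sub, Matrix.mulVec_smul, Matrix.mulVec_smul]
        funext i
        fin_cases i
        · change x q * x p - x p * x q = 0
          ring
        · change x q * (A *ᵥ intCast p) 1 - x p * (A *ᵥ intCast q) 1 = 0
          rw [hw1 p hp, hw1 q hq, hpq]
          ring
        · change x q * (A *ᵥ intCast p) 2 - x p * (A *ᵥ intCast q) 2 = 0
          rw [hw2 p hp, hw2 q hq, hpq]
          ring
      have hcoord : ∀ i, x q * (p i : ℝ) = x p * (q i : ℝ) := fun i =>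
        sub_eq_zero.mp (congrFun hlin i)
      intro i j
      have : (p i : ℝ) * q j = p j * q i := by
        apply mul_left_cancel₀ (hx q hq)
        linear_combination (q j : ℝ) * hcoord i - (q i : ℝ) * hcoord j
      exact_mod_cast this
    rcases hprop a ha.1 b hb.1 (ha.2.trans hb.2.symm) with h | h
    · exact hab h
    rcases hprop a ha.1 d hd.1 (ha.2.trans hd.2.symm) with h' | h'
    · exact had h'
    exact hbd (neg_injective (h.symm.trans h'))
  · intro a ha b hb d hd hab had hbd hfab hfad
    have hmem : ∀ j, (![a, b, d] : Fin 3 → Fin 3 → ℤ) j ∈ F := by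
      intro j
      fin_cases j
      exacts [ha, hb, hd]
    have hvol := two_mul_abs_det_le_vandermonde A ![a, b, d] (fun j => x (![a, b, d] j))
      (fun j => s (![a, b, d] j)) (fun j => hx _ (hmem j)) (fun j => rfl)
      (fun j => hw1 _ (hmem j)) (fun j => hw2 _ (hmem j)) hab had hbd
    change 2 * |A.det| ≤ |x a * x b * x d| * (|s a - s b| * |s a - s d| * |s b - s d|) at hvol
    have hη' : 0 < η / T := by positivity
    have d1 := (abs_sub_lt_of_floor_div_eq hη' hfab).le
    have d2 := (abs_sub_lt_of_floor_div_eq hη' hfad).le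
    have d3 := (abs_sub_lt_of_floor_div_eq hη' (hfab.symm.trans hfad)).le
    have b1 : |x a * x b * x d| ≤ T * T * T := by
      rw [abs_mul, abs_mul]
      exact mul_le_mul (mul_le_mul (hF a ha).2.2.1 (hF b hb).2.2.1 (abs_nonneg _) hT0.le)
        (hF d hd).2.2.1 (abs_nonneg _) (by positivity)
    have b2 : |s a - s b| * |s a - s d| * |s b - s d| ≤ η / T * (η / T) * (η / T) := by gcongr
    have b3 := mul_le_mul b1 b2 (by positivity) (by positivity)
    have b4 : T * T * T * (η / T * (η / T) * (η / T)) = η ^ 3 := by field_simp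
    have : 0 < η ^ 3 := by positivity
    linarith

theorem card_isotropic_le (A : Matrix (Fin 3) (Fin 3) ℝ) {η T : ℝ} (hA : A.det ≠ 0)
    (hη : 0 < η) (hη1 : η ≤ 1) (hT : 1 ≤ T) (hdet : η ^ 3 ≤ |A.det|) (F : Finset (Fin 3 → ℤ))
    (hF : ∀ m ∈ F, PrimVec m ∧ Q0 (A *ᵥ intCast m) = 0 ∧ eNorm (A *ᵥ intCast m) ≤ T) :
    (F.card : ℝ) ≤ 48 / η * T := by
  classical
  have hlo := card_isotropic_le_of_abs_two_le_abs_zero A hA hη hη1 hT hdet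
    (F.filter fun m => |(A *ᵥ intCast m) 2| ≤ |(A *ᵥ intCast m) 0|) fun m hm => by
      obtain ⟨hmF, hle⟩ := Finset.mem_filter.mp hm
      exact ⟨(hF m hmF).1, (hF m hmF).2.1, (abs_le_eNorm _ 0).trans (hF m hmF).2.2, hle⟩
  set B := A.submatrix (Equiv.swap (0 : Fin 3) 2) id with hB
  have hBdet : B.det = -A.det := by
    rw [hB, Matrix.det_permute, Equiv.Perm.sign_swap (by decide)]
    simp
  have hB0 : ∀ v, (B *ᵥ v) 0 = (A *ᵥ v) 2 := fun v => rfl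
  have hB1 : ∀ v, (B *ᵥ v) 1 = (A *ᵥ v) 1 := fun v => rfl
  have hB2 : ∀ v, (B *ᵥ v) 2 = (A *ᵥ v) 0 := fun v => rfl
  have hhi := card_isotropic_le_of_abs_two_le_abs_zero B (by rwa [hBdet, neg_ne_zero]) hη hη1 hT
    (by rwa [hBdet, abs_neg])
    (F.filter fun m => ¬|(A *ᵥ intCast m) 2| ≤ |(A *ᵥ intCast m) 0|) fun m hm => by
      obtain ⟨hmF, hle⟩ := Finset.mem_filter.mp hm
      have hq := (hF m hmF).2.1
      rw [Q0] at hq ⊢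
      rw [hB0, hB1, hB2]
      exact ⟨(hF m hmF).1, by linarith, (abs_le_eNorm _ 2).trans (hF m hmF).2.2, by linarith⟩
  have hsum : (F.card : ℝ) = _ := congrArg (Nat.cast (R := ℝ))
    (Finset.card_filter_add_card_filter_not
      (s := F) (fun m => |(A *ᵥ intCast m) 2| ≤ |(A *ᵥ intCast m) 0|)).symm
  push_cast at hsum
  have : 48 / η * T = 24 / η * T + 24 / η * T := by ring
  linarith

theorem stmt_12 (c : ℝ) (hc : 0 < c) (k : ℕ) :
    ∃ τ₀ : ℝ, 0 < τ₀ ∧ ∀ τ : ℝ, 0 < τ → τ ≤ τ₀ →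
      ∃ C T₀ : ℝ, 0 < C ∧ 2 ≤ T₀ ∧ ∀ T : ℝ, T₀ ≤ T →
        ∀ g : Matrix (Fin 3) (Fin 3) ℚ, g.det ≠ 0 →
          (∀ i j, |((g i j).num : ℝ)| ≤ T ^ ((k : ℝ) * τ) ∧
            ((g i j).den : ℝ) ≤ T ^ ((k : ℝ) * τ)) →
          |((g.det : ℚ) : ℝ)| ≤ T ^ τ →
          (∀ m : Fin 3 → ℤ, m ≠ 0 →
            c ≤ eNorm ((g.map (Rat.cast : ℚ → ℝ)) *ᵥ intCast m)) →
          (Nat.card {m : Fin 3 → ℤ | PrimVec m ∧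
            Q0 ((g.map (Rat.cast : ℚ → ℝ)) *ᵥ intCast m) = 0 ∧
            eNorm ((g.map (Rat.cast : ℚ → ℝ)) *ᵥ intCast m) ≤ T} : ℝ) ≤ C * T := by
  refine ⟨1, one_pos, fun τ _ _ => ?_⟩
  have hη : 0 < min 1 (c / 2) := lt_min one_pos (half_pos hc)
  refine ⟨48 / min 1 (c / 2), 2, by positivity, le_rfl, fun T hT g hg _ _ hmin => ?_⟩
  set A := g.map (Rat.cast : ℚ → ℝ) with hAdef
  have hA : A.det ≠ 0 := by
    have h : ((g.det : ℚ) : ℝ) = A.det := (Rat.castHom ℝ).map_det g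
    rw [← h]
    exact_mod_cast hg
  have hdet : min 1 (c / 2) ^ 3 ≤ |A.det| :=
    (pow_le_pow_left₀ hη.le (min_le_right _ _) 3).trans (le_abs_det_of_le_eNorm A hA hc hmin)
  rw [Nat.card_coe_set_eq]
  rcases Set.finite_or_infinite {m : Fin 3 → ℤ | PrimVec m ∧ Q0 (A *ᵥ intCast m) = 0 ∧
    eNorm (A *ᵥ intCast m) ≤ T} with hfin | hinf
  · rw [Set.ncard_eq_toFinset_card _ hfin]
    exact card_isotropic_le A hA hη (min_le_left _ _) (by linarith) hdet _
      fun m hm => hfin.mem_toFinset.mp hm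
  · rw [hinf.ncard, Nat.cast_zero]
    positivity

end
end

section
/- Let x = (x₁,x₂,x₃) ∈ ℝ³ be a Diophantine vector and let c > 0. Then there exist 0 < η₁ < η₂ < 1, C > 0 and δ₀ > 0 (depending on the Diophantine data of x) such that for all 0 < δ < δ₀: (a) for every T ≥ δ^{−η₂}, the number of primitive pairs (m,n) ∈ ℤ² with T/2 ≤ m² + n² ≤ T and dist(n²x₁ − 2mn·x₂ + m²x₃, ℤ) ≤ cδ is at most C·δ^{η₁}·T; and (b) there are at most two primitive pairs (m,n) ∈ ℤ² with m² + n² ≤ δ^{−η₂} satisfying dist(n²x₁ − 2mn·x₂ + m²x₃, ℤ) ≤ cδ, up to sign (i.e. the pairs (m,n) and (−m,−n) are not counted separately). -/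
noncomputable section

/-- `x` is `κ`-Diophantine. -/
def KDio {n : ℕ} (κ : ℝ) (x : Fin n → ℝ) : Prop :=
  ∃ C : ℝ, 0 < C ∧ ∀ δ : ℝ, 0 < δ → δ < 1 →
    ∀ p q : Fin n → ℤ, (∀ i, q i ≠ 0) → (∀ i, |(q i : ℝ)| < 1 / δ) →
      ∃ i, C * δ ^ κ < |x i - (p i : ℝ) / (q i : ℝ)|

/-- `x` is Diophantine. -/
def IsDiophantineVec {n : ℕ} (x : Fin n → ℝ) : Prop := ∃ κ : ℝ, 0 < κ ∧ KDio κ x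

/-- The inner product `⟨v^L, x⟩_B` of `x` with the primitive null vector
`v^L = (m², mn, n²)` of the split form `B(x₁,x₂,x₃) = x₁x₃ - x₂²`. -/
def nullPairing (x : Fin 3 → ℝ) (m n : ℤ) : ℝ :=
  (n : ℝ) ^ 2 * x 0 - 2 * (m : ℝ) * (n : ℝ) * x 1 + (m : ℝ) ^ 2 * x 2

/-- `dist(y, ℤ) ≤ ε`. -/
def distIntLE (y ε : ℝ) : Prop := ∃ z : ℤ, |y - (z : ℝ)| ≤ ε

lemma abs_sub_div_le_of_abs_mul_sub_le {a r : ℝ} {p q : ℤ} (hq : q ≠ 0)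
    (h : |(q : ℝ) * a - p| ≤ r) : |a - (p : ℝ) / q| ≤ r := by
  have hq' : (q : ℝ) ≠ 0 := by exact_mod_cast hq
  have h1 : (1 : ℝ) ≤ |(q : ℝ)| := by exact_mod_cast Int.one_le_abs hq
  have h2 : (q : ℝ) * a - p = q * (a - (p : ℝ) / q) := by field_simp
  rw [h2, abs_mul] at h
  exact (le_mul_of_one_le_left (abs_nonneg _) h1).trans h

/-- A second divided difference: if a real quadratic polynomial is nearly integral at three distinct
integers lying close together, then its leading coefficient is nearly rational. -/
lemma exists_rat_approx_leadingCoeff {a b e ε D : ℝ} {u v w : ℤ}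
    (huv : u ≠ v) (hvw : v ≠ w) (huw : u ≠ w)
    (duv : |(u : ℝ) - v| ≤ D) (dvw : |(v : ℝ) - w| ≤ D) (duw : |(u : ℝ) - w| ≤ D)
    (hu : distIntLE (a * u ^ 2 + b * u + e) ε) (hv : distIntLE (a * v ^ 2 + b * v + e) ε)
    (hw : distIntLE (a * w ^ 2 + b * w + e) ε) :
    ∃ p q : ℤ, q ≠ 0 ∧ |(q : ℝ)| ≤ D ^ 3 ∧ |a - (p : ℝ) / q| ≤ 3 * D * ε := by
  obtain ⟨i, hi⟩ := hu
  obtain ⟨j, hj⟩ := hv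
  obtain ⟨k, hk⟩ := hw
  have hq : (u - v) * (v - w) * (u - w) ≠ 0 :=
    mul_ne_zero (mul_ne_zero (sub_ne_zero.2 huv) (sub_ne_zero.2 hvw)) (sub_ne_zero.2 huw)
  have hD : 0 ≤ D := (abs_nonneg _).trans duv
  have hε : 0 ≤ ε := (abs_nonneg _).trans hi
  refine ⟨i * (v - w) - j * (u - w) + k * (u - v), (u - v) * (v - w) * (u - w), hq, ?_, ?_⟩
  · push_cast
    rw [abs_mul, abs_mul]
    calc _ ≤ D * D * D := by gcongr
      _ = D ^ 3 := by ring
  · refine abs_sub_div_le_of_abs_mul_sub_le hq ?_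
    set U := a * u ^ 2 + b * u + e - i with hU
    set V := a * v ^ 2 + b * v + e - j with hV
    set W := a * w ^ 2 + b * w + e - k with hW
    have key : (((u - v) * (v - w) * (u - w) : ℤ) : ℝ) * a
        - ((i * (v - w) - j * (u - w) + k * (u - v) : ℤ) : ℝ)
        = U * (v - w) - V * (u - w) + W * (u - v) := by
      push_cast; rw [hU, hV, hW]; ring
    rw [key]
    have h1 : |U * ((v : ℝ) - w)| ≤ ε * D := by rw [abs_mul]; gcongr
    have h2 : |V * ((u : ℝ) - w)| ≤ ε * D := by rw [abs_mul]; gcongr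
    have h3 : |W * ((u : ℝ) - v)| ≤ ε * D := by rw [abs_mul]; gcongr
    rw [abs_le] at h1 h2 h3 ⊢
    constructor <;> linarith

/-- Many lattice points in a square force three of them to be close together on a common
horizontal line. -/
lemma exists_three_close_on_line {S : Finset (ℤ × ℤ)} {M D : ℤ} (hD : 1 ≤ D) (hDM : D ≤ M)
    (hS : ∀ p ∈ S, |p.1| ≤ M ∧ |p.2| ≤ M) (hcard : 24 * M ^ 2 < D * S.card) :
    ∃ u v w n : ℤ, u ≠ v ∧ v ≠ w ∧ u ≠ w ∧ (u, n) ∈ S ∧ (v, n) ∈ S ∧ (w, n) ∈ S ∧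
      |u - v| ≤ D ∧ |v - w| ≤ D ∧ |u - w| ≤ D := by
  have hD0 : 0 < D := by omega
  have hM0 : 0 ≤ M / D := Int.ediv_nonneg (by omega) hD0.le
  have hmaps : ∀ p ∈ S, ((p.1 / D, p.2) : ℤ × ℤ) ∈
      Finset.Icc (-(M / D) - 1) (M / D) ×ˢ Finset.Icc (-M) M := by
    intro p hp
    obtain ⟨h1, h2⟩ := hS p hp
    rw [abs_le] at h1 h2
    have hlow : -(M / D) - 1 ≤ p.1 / D := by
      rw [Int.le_ediv_iff_mul_le hD0]
      have := Int.lt_ediv_add_one_mul_self M hD0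
      linarith
    simp only [Finset.mem_product, Finset.mem_Icc]
    exact ⟨⟨hlow, Int.ediv_le_ediv hD0 h1.2⟩, h2⟩
  have hcells : (Finset.Icc (-(M / D) - 1) (M / D) ×ˢ Finset.Icc (-M) M).card * 2 < S.card := by
    rw [Finset.card_product, Int.card_Icc, Int.card_Icc]
    zify
    rw [Int.toNat_of_nonneg (by omega), Int.toNat_of_nonneg (by omega)]
    refine lt_of_mul_lt_mul_left (lt_of_le_of_lt ?_ hcard) hD0.le
    have hdiv : D * (M / D) ≤ M := Int.mul_ediv_self_le (by omega)
    have h4 : D * (M / D + 1 - (-(M / D) - 1)) ≤ 4 * M := by linarith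
    have h3 : M + 1 - -M ≤ 3 * M := by linarith
    calc _ = D * (M / D + 1 - (-(M / D) - 1)) * (M + 1 - -M) * 2 := by ring
      _ ≤ 4 * M * (3 * M) * 2 := by
        gcongr
        · linarith
        · linarith
      _ = 24 * M ^ 2 := by ring
  have hclose : ∀ {u v : ℤ}, u / D = v / D → |u - v| ≤ D := by
    intro u v h
    have hu := Int.lt_ediv_add_one_mul_self u hD0
    have hv := Int.lt_ediv_add_one_mul_self v hD0
    have hu' := Int.ediv_mul_le u hD0.ne'
    have hv' := Int.ediv_mul_le v hD0.ne'
    rw [h] at hu hu'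
    rw [abs_le]
    constructor <;> linarith
  obtain ⟨y, -, hy⟩ := Finset.exists_lt_card_fiber_of_mul_lt_card_of_maps_to hmaps hcells
  obtain ⟨⟨u, k⟩, ⟨v, l⟩, ⟨w, n⟩, hu, hv, hw, huv, huw, hvw⟩ := Finset.two_lt_card_iff.1 hy
  simp only [Finset.mem_filter, Prod.ext_iff] at hu hv hw
  obtain rfl : k = n := hu.2.2.trans hw.2.2.symm
  obtain rfl : l = k := hv.2.2.trans hu.2.2.symm
  exact ⟨u, v, w, l, fun h => huv (by rw [h]), fun h => hvw (by rw [h]), fun h => huw (by rw [h]),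
    hu.1, hv.1, hw.1, hclose (hu.2.1.trans hv.2.1.symm), hclose (hv.2.1.trans hw.2.1.symm),
    hclose (hu.2.1.trans hw.2.1.symm)⟩

/-- If `g` is nearly integral at many lattice points and is, in the coordinates `φ`, quadratic along
horizontal lines with constant leading coefficient `a`, then `a` is nearly rational. -/
lemma exists_rat_approx_of_card {S : Finset (ℤ × ℤ)} {M D : ℤ} {ε a : ℝ} {g : ℤ × ℤ → ℝ}
    (φ : ℤ × ℤ → ℤ × ℤ) (b e : ℤ → ℝ) (hφ : Function.Injective φ) (hD : 1 ≤ D) (hDM : D ≤ M)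
    (hS : ∀ p ∈ S, |(φ p).1| ≤ M ∧ |(φ p).2| ≤ M) (hcard : 24 * M ^ 2 < D * S.card)
    (hg : ∀ p, g p = a * (φ p).1 ^ 2 + b (φ p).2 * (φ p).1 + e (φ p).2)
    (hgS : ∀ p ∈ S, distIntLE (g p) ε) :
    ∃ p q : ℤ, q ≠ 0 ∧ |(q : ℝ)| ≤ (D : ℝ) ^ 3 ∧ |a - (p : ℝ) / q| ≤ 3 * D * ε := by
  classical
  obtain ⟨u, v, w, n, huv, hvw, huw, hu, hv, hw, duv, dvw, duw⟩ :=
    exists_three_close_on_line (S := S.image φ) hD hDM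
      (by simpa only [Finset.forall_mem_image] using hS)
      (by rwa [Finset.card_image_of_injective _ hφ])
  have hval : ∀ {u : ℤ}, (u, n) ∈ S.image φ → distIntLE (a * u ^ 2 + b n * u + e n) ε := by
    intro u hu
    obtain ⟨p, hp, hpu⟩ := Finset.mem_image.1 hu
    have := hgS p hp
    rwa [hg, hpu] at this
  exact exists_rat_approx_leadingCoeff huv hvw huw (by exact_mod_cast duv) (by exact_mod_cast dvw)
    (by exact_mod_cast duw) (hval hu) (hval hv) (hval hw)

/-- If the null pairing with `x` is nearly integral at many lattice points of a square, then all
coordinates of `x` are nearly rational. -/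
lemma exists_rat_approx_of_card_nullPairing {x : Fin 3 → ℝ} {S : Finset (ℤ × ℤ)} {R D : ℤ} {ε : ℝ}
    (hD : 1 ≤ D) (hDR : D ≤ 2 * R) (hS : ∀ p ∈ S, |p.1| ≤ R ∧ |p.2| ≤ R)
    (hcard : 96 * R ^ 2 < D * S.card) (hgS : ∀ p ∈ S, distIntLE (nullPairing x p.1 p.2) ε)
    (hε : 0 ≤ ε) :
    ∃ p q : Fin 3 → ℤ, (∀ i, q i ≠ 0) ∧ (∀ i, |(q i : ℝ)| ≤ 2 * (D : ℝ) ^ 9) ∧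
      ∀ i, |x i - (p i : ℝ) / q i| ≤ 5 * D * ε := by
  have hcard' : 24 * (2 * R) ^ 2 < D * (S.card : ℤ) := by linarith
  have hSR : ∀ p ∈ S, |p.1| ≤ 2 * R ∧ |p.2| ≤ 2 * R ∧ |p.1 - p.2| ≤ 2 * R := by
    intro p hp
    obtain ⟨h1, h2⟩ := hS p hp
    simp only [abs_le] at *
    omega
  obtain ⟨p2, q2, hq2, hq2D, h2⟩ := exists_rat_approx_of_card (a := x 2) id
    (fun n => -2 * n * x 1) (fun n => n ^ 2 * x 0) Function.injective_id hD hDR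
    (fun p hp => ⟨(hSR p hp).1, (hSR p hp).2.1⟩) hcard'
    (fun p => by simp only [nullPairing, id]; ring) hgS
  obtain ⟨p0, q0, hq0, hq0D, h0⟩ := exists_rat_approx_of_card (a := x 0) Prod.swap
    (fun m => -2 * m * x 1) (fun m => m ^ 2 * x 2) Prod.swap_injective hD hDR
    (fun p hp => ⟨(hSR p hp).2.1, (hSR p hp).1⟩) hcard'
    (fun p => by simp only [nullPairing, Prod.fst_swap, Prod.snd_swap]; ring) hgS
  obtain ⟨p1, q1, hq1, hq1D, h1⟩ := exists_rat_approx_of_card (a := x 0 - 2 * x 1 + x 2)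
    (fun p => (p.2, p.1 - p.2)) (fun d => 2 * d * (x 2 - x 1)) (fun d => d ^ 2 * x 2)
    (fun p r h => by simp only [Prod.ext_iff] at h ⊢; omega) hD hDR
    (fun p hp => (hSR p hp).2) hcard'
    (fun p => by simp only [nullPairing]; push_cast; ring) hgS
  have hD1 : (1 : ℝ) ≤ D := by exact_mod_cast hD
  have hD39 : (D : ℝ) ^ 3 ≤ 2 * (D : ℝ) ^ 9 := by
    have : (D : ℝ) ^ 3 ≤ (D : ℝ) ^ 9 := pow_le_pow_right₀ hD1 (by norm_num)
    linarith [pow_nonneg (zero_le_one.trans hD1) 3]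
  have hDε : 0 ≤ D * ε := by positivity
  refine ⟨![p0, p0 * q1 * q2 + p2 * q0 * q1 - p1 * q0 * q2, p2], ![q0, 2 * q0 * q1 * q2, q2],
    ?_, ?_, ?_⟩
  · simp [Fin.forall_fin_succ, hq0, hq1, hq2]
  · simp only [Fin.forall_fin_succ, Matrix.cons_val_zero, Matrix.cons_val_succ, IsEmpty.forall_iff,
      and_true]
    refine ⟨hq0D.trans hD39, ?_, hq2D.trans hD39⟩
    push_cast
    rw [abs_mul, abs_mul, abs_mul, abs_two]
    calc _ ≤ 2 * (D : ℝ) ^ 3 * (D : ℝ) ^ 3 * (D : ℝ) ^ 3 := by gcongr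
      _ = _ := by ring
  · have hq0' : (q0 : ℝ) ≠ 0 := by exact_mod_cast hq0
    have hq1' : (q1 : ℝ) ≠ 0 := by exact_mod_cast hq1
    have hq2' : (q2 : ℝ) ≠ 0 := by exact_mod_cast hq2
    have hx1 : x 1 - ((p0 * q1 * q2 + p2 * q0 * q1 - p1 * q0 * q2 : ℤ) : ℝ)
        / ((2 * q0 * q1 * q2 : ℤ) : ℝ)
        = ((x 0 - p0 / q0) + (x 2 - p2 / q2) - (x 0 - 2 * x 1 + x 2 - p1 / q1)) / 2 := by
      push_cast; field_simp; ring
    intro i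
    rw [abs_le] at h0 h1 h2
    fin_cases i
    · change |x 0 - p0 / q0| ≤ _
      rw [abs_le]; constructor <;> linarith
    · change |x 1 - ((p0 * q1 * q2 + p2 * q0 * q1 - p1 * q0 * q2 : ℤ) : ℝ)
        / ((2 * q0 * q1 * q2 : ℤ) : ℝ)| ≤ _
      rw [hx1, abs_le]; constructor <;> linarith
    · change |x 2 - p2 / q2| ≤ _
      rw [abs_le]; constructor <;> linarith

/-- Cramer's rule for a `3 × 3` integral system with nearly integral right-hand side. -/
lemma abs_sub_div_le_of_cramer {t V₁ V₂ V₃ ε r : ℝ} {q c₁ c₂ c₃ z₁ z₂ z₃ : ℤ} (hq : q ≠ 0)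
    (h : q * t = c₁ * V₁ + c₂ * V₂ + c₃ * V₃) (hc₁ : |(c₁ : ℝ)| ≤ r) (hc₂ : |(c₂ : ℝ)| ≤ r)
    (hc₃ : |(c₃ : ℝ)| ≤ r) (h₁ : |V₁ - z₁| ≤ ε) (h₂ : |V₂ - z₂| ≤ ε) (h₃ : |V₃ - z₃| ≤ ε) :
    |t - ((c₁ * z₁ + c₂ * z₂ + c₃ * z₃ : ℤ) : ℝ) / q| ≤ 3 * (r * ε) := by
  refine abs_sub_div_le_of_abs_mul_sub_le hq ?_
  have hr : 0 ≤ r := (abs_nonneg _).trans hc₁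
  have key : (q : ℝ) * t - ((c₁ * z₁ + c₂ * z₂ + c₃ * z₃ : ℤ) : ℝ)
      = c₁ * (V₁ - z₁) + c₂ * (V₂ - z₂) + c₃ * (V₃ - z₃) := by
    rw [h]; push_cast; ring
  have k₁ : |c₁ * (V₁ - z₁)| ≤ r * ε := by rw [abs_mul]; gcongr
  have k₂ : |c₂ * (V₂ - z₂)| ≤ r * ε := by rw [abs_mul]; gcongr
  have k₃ : |c₃ * (V₃ - z₃)| ≤ r * ε := by rw [abs_mul]; gcongr
  rw [key]
  rw [abs_le] at k₁ k₂ k₃ ⊢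
  constructor <;> linarith

lemma abs_mul_le_sq {a b B : ℝ} (ha : |a| ≤ B) (hb : |b| ≤ B) : |a * b| ≤ B ^ 2 := by
  rw [abs_mul, sq]
  exact mul_le_mul ha hb (abs_nonneg _) ((abs_nonneg _).trans ha)

/-- If the null pairing with `x` is nearly integral at three pairwise independent small integer
vectors, then all coordinates of `x` are nearly rational. -/
lemma exists_rat_approx_of_three {x : Fin 3 → ℝ} {B ε : ℝ} {m₁ n₁ m₂ n₂ m₃ n₃ : ℤ}
    (hm₁ : |(m₁ : ℝ)| ≤ B) (hn₁ : |(n₁ : ℝ)| ≤ B) (hm₂ : |(m₂ : ℝ)| ≤ B) (hn₂ : |(n₂ : ℝ)| ≤ B)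
    (hm₃ : |(m₃ : ℝ)| ≤ B) (hn₃ : |(n₃ : ℝ)| ≤ B)
    (h₁₂ : m₁ * n₂ - m₂ * n₁ ≠ 0) (h₂₃ : m₂ * n₃ - m₃ * n₂ ≠ 0) (h₃₁ : m₃ * n₁ - m₁ * n₃ ≠ 0)
    (h₁ : distIntLE (nullPairing x m₁ n₁) ε) (h₂ : distIntLE (nullPairing x m₂ n₂) ε)
    (h₃ : distIntLE (nullPairing x m₃ n₃) ε) :
    ∃ p q : Fin 3 → ℤ, (∀ i, q i ≠ 0) ∧ (∀ i, |(q i : ℝ)| ≤ 16 * B ^ 6) ∧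
      ∀ i, |x i - (p i : ℝ) / q i| ≤ 12 * B ^ 4 * ε := by
  obtain ⟨z₁, hz₁⟩ := h₁
  obtain ⟨z₂, hz₂⟩ := h₂
  obtain ⟨z₃, hz₃⟩ := h₃
  set d₁₂ := m₁ * n₂ - m₂ * n₁ with hd₁₂
  set d₂₃ := m₂ * n₃ - m₃ * n₂ with hd₂₃
  set d₃₁ := m₃ * n₁ - m₁ * n₃ with hd₃₁
  have hq : 2 * d₁₂ * d₂₃ * d₃₁ ≠ 0 := by simp [h₁₂, h₂₃, h₃₁]
  have hd : ∀ {a b c d : ℤ}, |(a : ℝ)| ≤ B → |(b : ℝ)| ≤ B → |(c : ℝ)| ≤ B → |(d : ℝ)| ≤ B →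
      |((a * b - c * d : ℤ) : ℝ)| ≤ 2 * B ^ 2 := by
    intro a b c d ha hb hc hd
    push_cast
    have h1 := abs_mul_le_sq ha hb
    have h2 := abs_mul_le_sq hc hd
    rw [abs_le] at h1 h2 ⊢
    constructor <;> linarith
  have hs : ∀ {a b c d : ℤ}, |(a : ℝ)| ≤ B → |(b : ℝ)| ≤ B → |(c : ℝ)| ≤ B → |(d : ℝ)| ≤ B →
      |((a * b + c * d : ℤ) : ℝ)| ≤ 2 * B ^ 2 := by
    intro a b c d ha hb hc hd
    push_cast
    have h1 := abs_mul_le_sq ha hb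
    have h2 := abs_mul_le_sq hc hd
    rw [abs_le] at h1 h2 ⊢
    constructor <;> linarith
  have b₁₂ : |(d₁₂ : ℝ)| ≤ 2 * B ^ 2 := hd hm₁ hn₂ hm₂ hn₁
  have b₂₃ : |(d₂₃ : ℝ)| ≤ 2 * B ^ 2 := hd hm₂ hn₃ hm₃ hn₂
  have b₃₁ : |(d₃₁ : ℝ)| ≤ 2 * B ^ 2 := hd hm₃ hn₁ hm₁ hn₃
  have hcof : ∀ {d s : ℤ}, |(d : ℝ)| ≤ 2 * B ^ 2 → |(s : ℝ)| ≤ 2 * B ^ 2 →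
      |((d * s : ℤ) : ℝ)| ≤ 4 * B ^ 4 := by
    intro d s h1 h2
    push_cast
    exact (abs_mul_le_sq h1 h2).trans_eq (by ring)
  have hbound : ∀ t : ℝ, t ≤ 3 * (4 * B ^ 4 * ε) → t ≤ 12 * B ^ 4 * ε := fun t ht => by linarith
  refine ⟨![d₂₃ * (m₂ * m₃ + m₂ * m₃) * z₁ + d₃₁ * (m₃ * m₁ + m₃ * m₁) * z₂
        + d₁₂ * (m₁ * m₂ + m₁ * m₂) * z₃,
      d₂₃ * (m₂ * n₃ + m₃ * n₂) * z₁ + d₃₁ * (m₃ * n₁ + m₁ * n₃) * z₂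
        + d₁₂ * (m₁ * n₂ + m₂ * n₁) * z₃,
      d₂₃ * (n₂ * n₃ + n₂ * n₃) * z₁ + d₃₁ * (n₃ * n₁ + n₃ * n₁) * z₂
        + d₁₂ * (n₁ * n₂ + n₁ * n₂) * z₃],
    fun _ => -(2 * d₁₂ * d₂₃ * d₃₁), fun _ => neg_ne_zero.2 hq, fun _ => ?_, fun i => hbound _ ?_⟩
  · push_cast
    rw [abs_neg, abs_mul, abs_mul, abs_mul, abs_two]
    calc _ ≤ 2 * (2 * B ^ 2) * (2 * B ^ 2) * (2 * B ^ 2) := by gcongr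
      _ = _ := by ring
  · fin_cases i
    · refine abs_sub_div_le_of_cramer (neg_ne_zero.2 hq) ?_ (hcof b₂₃ (hs hm₂ hm₃ hm₂ hm₃))
        (hcof b₃₁ (hs hm₃ hm₁ hm₃ hm₁)) (hcof b₁₂ (hs hm₁ hm₂ hm₁ hm₂)) hz₁ hz₂ hz₃
      simp only [nullPairing, hd₁₂, hd₂₃, hd₃₁]; push_cast; ring!
    · refine abs_sub_div_le_of_cramer (neg_ne_zero.2 hq) ?_ (hcof b₂₃ (hs hm₂ hn₃ hm₃ hn₂))
        (hcof b₃₁ (hs hm₃ hn₁ hm₁ hn₃)) (hcof b₁₂ (hs hm₁ hn₂ hm₂ hn₁)) hz₁ hz₂ hz₃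
      simp only [nullPairing, hd₁₂, hd₂₃, hd₃₁]; push_cast; ring!
    · refine abs_sub_div_le_of_cramer (neg_ne_zero.2 hq) ?_ (hcof b₂₃ (hs hn₂ hn₃ hn₂ hn₃))
        (hcof b₃₁ (hs hn₃ hn₁ hn₃ hn₁)) (hcof b₁₂ (hs hn₁ hn₂ hn₁ hn₂)) hz₁ hz₂ hz₃
      simp only [nullPairing, hd₁₂, hd₂₃, hd₃₁]; push_cast; ring!

/-- Two primitive integer vectors with vanishing determinant agree up to sign. -/
lemma eq_or_eq_neg_of_det_eq_zero {m n k l : ℤ} (h : IsCoprime m n) (h' : IsCoprime k l)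
    (hdet : m * l - k * n = 0) : ((k, l) : ℤ × ℤ) = (m, n) ∨ ((k, l) : ℤ × ℤ) = -(m, n) := by
  obtain ⟨a, b, hab⟩ := h
  obtain ⟨a', b', hab'⟩ := h'
  have hk : k = (a * k + b * l) * m := by linear_combination -k * hab - b * hdet
  have hl : l = (a * k + b * l) * n := by linear_combination -l * hab + a * hdet
  have hunit : IsUnit (a * k + b * l) :=
    IsUnit.of_mul_eq_one (a' * m + b' * n) (by linear_combination hab' - a' * hk - b' * hl)
  rcases Int.isUnit_iff.1 hunit with h1 | h1 <;> rw [h1] at hk hl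
  · left; simp_all
  · right; simp_all

/-- A Diophantine vector has no good rational approximation of small height, in power form. -/
lemma IsDiophantineVec.exists_exponent {n : ℕ} {x : Fin n → ℝ} (hx : IsDiophantineVec x) :
    ∃ θ : ℝ, 0 < θ ∧ θ < 1 ∧ ∀ K : ℝ, 0 < K → ∃ δ₀ : ℝ, 0 < δ₀ ∧ δ₀ ≤ 1 ∧
      ∀ δ : ℝ, 0 < δ → δ < δ₀ → ∀ p q : Fin n → ℤ, (∀ i, q i ≠ 0) →
        (∀ i, |(q i : ℝ)| ≤ K * δ ^ (-θ)) →
        ¬ ∀ i, |x i - (p i : ℝ) / q i| ≤ K * δ ^ (1 - θ) := by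
  obtain ⟨κ, hκ, C, hC, h⟩ := hx
  set θ : ℝ := 1 / (2 * κ + 2) with hθ
  have hθ0 : 0 < θ := by positivity
  have hθκ : 1 - θ = 2 * θ * κ + θ := by rw [hθ]; field_simp; ring
  have hθ1 : θ < 1 := by nlinarith
  refine ⟨θ, hθ0, hθ1, fun K hK => ?_⟩
  set r : ℝ := min 1 C / K with hr
  have hr0 : 0 < r := by positivity
  refine ⟨min 1 (r ^ (1 / θ)), by positivity, min_le_left _ _, ?_⟩
  intro δ hδ hδ₀ p q hq hqK hall
  have hδ1 : δ < 1 := hδ₀.trans_le (min_le_left _ _)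
  have hδr : K * δ ^ θ < min 1 C := by
    have h1 : δ ^ θ < (r ^ (1 / θ)) ^ θ :=
      Real.rpow_lt_rpow hδ.le (hδ₀.trans_le (min_le_right _ _)) hθ0
    rw [← Real.rpow_mul hr0.le, one_div_mul_cancel hθ0.ne', Real.rpow_one, hr,
      lt_div_iff₀ hK] at h1
    linarith
  obtain ⟨i, hi⟩ := h (δ ^ (2 * θ)) (by positivity) (Real.rpow_lt_one hδ.le hδ1 (by positivity))
    p q hq (fun i => by
      have h1 : K * δ ^ (-θ) = K * δ ^ θ * (1 / δ ^ (2 * θ)) := by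
        rw [one_div, ← Real.rpow_neg hδ.le, mul_assoc, ← Real.rpow_add hδ]; ring_nf
      refine (hqK i).trans_lt ?_
      rw [h1]
      exact mul_lt_of_lt_one_left (by positivity) (hδr.trans_le (min_le_left _ _)))
  refine absurd (hall i) (not_le.2 (lt_of_le_of_lt ?_ hi))
  rw [hθκ, Real.rpow_add hδ, ← Real.rpow_mul hδ.le]
  calc K * (δ ^ (2 * θ * κ) * δ ^ θ) = K * δ ^ θ * δ ^ (2 * θ * κ) := by ring
    _ ≤ C * δ ^ (2 * θ * κ) := by
      gcongr
      exact hδr.le.trans (min_le_right _ _)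

theorem stmt_13 (x : Fin 3 → ℝ) (hx : IsDiophantineVec x) (c : ℝ) (hc : 0 < c) :
    ∃ η₁ η₂ C δ₀ : ℝ, 0 < η₁ ∧ η₁ < η₂ ∧ η₂ < 1 ∧ 0 < C ∧ 0 < δ₀ ∧
      ∀ δ : ℝ, 0 < δ → δ < δ₀ →
        -- (a)
        (∀ T : ℝ, δ ^ (-η₂) ≤ T →
          (Nat.card {p : ℤ × ℤ | IsCoprime p.1 p.2 ∧
            T / 2 ≤ ((p.1 ^ 2 + p.2 ^ 2 : ℤ) : ℝ) ∧ ((p.1 ^ 2 + p.2 ^ 2 : ℤ) : ℝ) ≤ T ∧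
            distIntLE (nullPairing x p.1 p.2) (c * δ)} : ℝ) ≤ C * δ ^ η₁ * T) ∧
        -- (b): at most two such pairs, up to sign, in the range `m² + n² ≤ δ^{-η₂}`
        (∃ p₁ p₂ : ℤ × ℤ,
          ∀ p : ℤ × ℤ, IsCoprime p.1 p.2 →
            ((p.1 ^ 2 + p.2 ^ 2 : ℤ) : ℝ) ≤ δ ^ (-η₂) →
            distIntLE (nullPairing x p.1 p.2) (c * δ) →
            p = p₁ ∨ p = -p₁ ∨ p = p₂ ∨ p = -p₂) := by
  obtain ⟨θ, hθ, hθ1, hdio⟩ := hx.exists_exponent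
  obtain ⟨δ₀, hδ₀, hδ₀1, hdio⟩ := hdio (1024 + 12 * c) (by positivity)
  refine ⟨θ / 24, θ / 6, 96, δ₀, by positivity, by linarith, by linarith, by norm_num, hδ₀, ?_⟩
  intro δ hδ hδlt
  have hδ1 : δ < 1 := hδlt.trans_le hδ₀1
  have hle : ∀ {k s t : ℝ}, k ≤ 1024 + 12 * c → s ≤ t →
      k * δ ^ t ≤ (1024 + 12 * c) * δ ^ s := fun hkl hst =>
    mul_le_mul hkl (Real.rpow_le_rpow_of_exponent_ge hδ hδ1.le hst) (by positivity) (by positivity)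
  have hpow : ∀ (s : ℝ) (k : ℕ), (δ ^ s) ^ k = δ ^ (s * k) := fun s k => by
    rw [Real.rpow_mul hδ.le, Real.rpow_natCast]
  refine ⟨fun T hT => ?_, ?_⟩
  · by_contra! hcard
    set A := {p : ℤ × ℤ | IsCoprime p.1 p.2 ∧
            T / 2 ≤ ((p.1 ^ 2 + p.2 ^ 2 : ℤ) : ℝ) ∧ ((p.1 ^ 2 + p.2 ^ 2 : ℤ) : ℝ) ≤ T ∧
            distIntLE (nullPairing x p.1 p.2) (c * δ)} with hA
    set y : ℝ := δ ^ (-(θ / 24)) with hy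
    have hy1 : 1 ≤ y := Real.one_le_rpow_of_pos_of_le_one_of_nonpos hδ hδ1.le (by linarith)
    have hyT : y ^ 4 ≤ T := by
      rw [hy, hpow]
      exact le_of_eq_of_le (by congr 1; push_cast; ring) hT
    have hT1 : 1 ≤ T := (one_le_pow₀ hy1).trans hyT
    have hT0 : 0 ≤ T := by linarith
    have hyδ : y * δ ^ (θ / 24) = 1 := by rw [hy, ← Real.rpow_add hδ]; simp
    have hfin : A.Finite := by
      refine Nat.finite_of_card_ne_zero fun h0 => ?_
      rw [h0, Nat.cast_zero] at hcard
      exact hcard.not_ge (by positivity)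
    have hS : ∀ p ∈ hfin.toFinset, |p.1| ≤ ⌊√T⌋ ∧ |p.2| ≤ ⌊√T⌋ := by
      intro p hp
      have hpT := ((hfin.mem_toFinset.1 hp).2).2.1
      push_cast at hpT
      rw [Int.le_floor, Int.le_floor, Int.cast_abs, Int.cast_abs]
      exact ⟨Real.abs_le_sqrt (by nlinarith), Real.abs_le_sqrt (by nlinarith)⟩
    have hsqrt : 1 ≤ ⌊√T⌋ := by
      rw [Int.le_floor]; simpa using hT1
    have hD : 1 ≤ ⌈y⌉ := by exact_mod_cast hy1.trans (Int.le_ceil y)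
    have hDR : ⌈y⌉ ≤ 2 * ⌊√T⌋ := by
      have h1 : y ≤ √T := Real.le_sqrt_of_sq_le
        ((pow_le_pow_right₀ hy1 (by norm_num : 2 ≤ 4)).trans hyT)
      have h2 : ⌈y⌉ ≤ ⌊√T⌋ + 1 := (Int.ceil_mono h1).trans (Int.ceil_le_floor_add_one _)
      omega
    have hc' : 96 * ⌊√T⌋ ^ 2 < ⌈y⌉ * (hfin.toFinset.card : ℤ) := by
      rw [← Nat.card_eq_card_finite_toFinset hfin]
      have h1 : (⌊√T⌋ : ℝ) ^ 2 ≤ T := by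
        have h0 : (0 : ℝ) ≤ ⌊√T⌋ := by exact_mod_cast (by omega : 0 ≤ ⌊√T⌋)
        calc (⌊√T⌋ : ℝ) ^ 2 ≤ √T ^ 2 := by gcongr; exact Int.floor_le _
          _ = T := Real.sq_sqrt hT0
      have h2 : (96 : ℝ) * (⌊√T⌋ : ℝ) ^ 2 < ⌈y⌉ * (Nat.card A : ℝ) := by
        calc (96 : ℝ) * (⌊√T⌋ : ℝ) ^ 2 ≤ 96 * T := by gcongr
          _ = y * (96 * δ ^ (θ / 24) * T) := by linear_combination -96 * T * hyδ
          _ < y * Nat.card A := by gcongr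
          _ ≤ _ := by gcongr; exact Int.le_ceil y
      exact_mod_cast h2
    obtain ⟨p, q, hq, hqB, hpq⟩ := exists_rat_approx_of_card_nullPairing hD hDR hS hc'
      (fun p hp => ((hfin.mem_toFinset.1 hp).2).2.2) (by positivity)
    have hDy : (⌈y⌉ : ℝ) ≤ 2 * y := by linarith [Int.ceil_lt_add_one y]
    have hD0 : (0 : ℝ) ≤ ⌈y⌉ := by exact_mod_cast (by omega : 0 ≤ ⌈y⌉)
    refine hdio δ hδ hδlt p q hq (fun i => (hqB i).trans ?_) (fun i => (hpq i).trans ?_)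
    · calc 2 * (⌈y⌉ : ℝ) ^ 9 ≤ 2 * (2 * y) ^ 9 := by gcongr
        _ = 1024 * y ^ 9 := by ring
        _ ≤ (1024 + 12 * c) * δ ^ (-θ) := by
          rw [hy, hpow]
          exact hle (by linarith) (by push_cast; linarith)
    · calc 5 * (⌈y⌉ : ℝ) * (c * δ) ≤ 5 * (2 * y) * (c * δ) := by gcongr
        _ = 10 * c * δ ^ (1 - θ / 24) := by
          rw [hy, sub_eq_add_neg, Real.rpow_add hδ, Real.rpow_one]; ring
        _ ≤ _ := hle (by linarith) (by linarith)
  · have hbd : ∀ {p : ℤ × ℤ}, ((p.1 ^ 2 + p.2 ^ 2 : ℤ) : ℝ) ≤ δ ^ (-(θ / 6)) →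
        |(p.1 : ℝ)| ≤ δ ^ (-(θ / 6)) ∧ |(p.2 : ℝ)| ≤ δ ^ (-(θ / 6)) := by
      intro p hp
      have h1 : |p.1| ≤ p.1 ^ 2 + p.2 ^ 2 := by
        linarith [Int.natAbs_le_self_sq p.1, Int.natCast_natAbs p.1, sq_nonneg p.2]
      have h2 : |p.2| ≤ p.1 ^ 2 + p.2 ^ 2 := by
        linarith [Int.natAbs_le_self_sq p.2, Int.natCast_natAbs p.2, sq_nonneg p.1]
      exact ⟨le_trans (by exact_mod_cast h1) hp, le_trans (by exact_mod_cast h2) hp⟩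
    by_contra! hno
    obtain ⟨p₁, a₁, b₁, e₁, -⟩ := hno 0 0
    obtain ⟨p₂, a₂, b₂, e₂, h₁₂, h₁₂', -⟩ := hno p₁ p₁
    obtain ⟨p₃, a₃, b₃, e₃, h₁₃, h₁₃', h₂₃, h₂₃'⟩ := hno p₁ p₂
    have hdet : ∀ {p r : ℤ × ℤ}, IsCoprime p.1 p.2 → IsCoprime r.1 r.2 → r ≠ p → r ≠ -p →
        p.1 * r.2 - r.1 * p.2 ≠ 0 := fun hp hr h h' h0 =>
      (eq_or_eq_neg_of_det_eq_zero hp hr h0).elim h h'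
    obtain ⟨p, q, hq, hqB, hpq⟩ := exists_rat_approx_of_three
      (hbd b₁).1 (hbd b₁).2 (hbd b₂).1 (hbd b₂).2 (hbd b₃).1 (hbd b₃).2
      (hdet a₁ a₂ h₁₂ h₁₂') (hdet a₂ a₃ h₂₃ h₂₃')
      (hdet a₃ a₁ h₁₃.symm fun h => h₁₃' (by rw [h, neg_neg])) e₁ e₂ e₃
    refine hdio δ hδ hδlt p q hq (fun i => (hqB i).trans ?_) (fun i => (hpq i).trans ?_)
    · rw [hpow]
      exact hle (by linarith) (by push_cast; linarith)
    · calc 12 * (δ ^ (-(θ / 6))) ^ 4 * (c * δ) = 12 * c * δ ^ (1 + -(θ / 6) * (4 : ℕ)) := by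
            rw [hpow, Real.rpow_add hδ, Real.rpow_one]; ring
        _ ≤ _ := hle (by linarith) (by push_cast; linarith)

end
end

section
/- Let x = (x₁,x₂,x₃,x₄) ∈ ℝ⁴ be a κ-Diophantine vector with constant C(x). Then for every 0 < τ′ ≤ 1/(32κ) there exist C′ > 0 and T₀ ≥ 2 such that for all T ≥ T₀ the following holds: if (a,b) and (a′,b′) are primitive pairs in ℤ² with 0 < ‖(a,b)‖ < T^{τ′} and 0 < ‖(a′,b′)‖ < T^{τ′}, and each of them admits rationals p₁/q₁, p₂/q₂ with |q₁|, |q₂| < T^{τ′} satisfying |a·x₁ − b·x₃ − p₁/q₁| < C′T^{−8κτ′} and |b·x₄ − a·x₂ − p₂/q₂| < C′T^{−8κτ′} (with its own rationals for each pair), then (a′,b′) = ±(a,b). -/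
noncomputable section

/-- `x` is `κ`-Diophantine with constant `C`. -/
def KDioWith {n : ℕ} (κ C : ℝ) (x : Fin n → ℝ) : Prop :=
  ∀ δ : ℝ, 0 < δ → δ < 1 →
    ∀ p q : Fin n → ℤ, (∀ i, q i ≠ 0) → (∀ i, |(q i : ℝ)| < 1 / δ) →
      ∃ i, C * δ ^ κ < |x i - (p i : ℝ) / (q i : ℝ)|

/-- The simultaneous approximation condition on a primitive pair `(a,b)`:
there are rationals `p₁/q₁`, `p₂/q₂` with `|qᵢ| < T^{τ'}` such that
`|a x₁ - b x₃ - p₁/q₁| < C' T^{-8κτ'}` and `|b x₄ - a x₂ - p₂/q₂| < C' T^{-8κτ'}`. -/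
def ApproxCond (x : Fin 4 → ℝ) (C' T τ' κ : ℝ) (a b : ℤ) : Prop :=
  ∃ p₁ q₁ p₂ q₂ : ℤ, q₁ ≠ 0 ∧ q₂ ≠ 0 ∧
    |(q₁ : ℝ)| < T ^ τ' ∧ |(q₂ : ℝ)| < T ^ τ' ∧
    |(a : ℝ) * x 0 - (b : ℝ) * x 2 - (p₁ : ℝ) / (q₁ : ℝ)| < C' * T ^ (-(8 * κ * τ')) ∧
    |(b : ℝ) * x 3 - (a : ℝ) * x 1 - (p₂ : ℝ) / (q₂ : ℝ)| < C' * T ^ (-(8 * κ * τ'))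

/-- A Diophantine exponent is at least one. -/
lemma KDioWith.one_le {n : ℕ} {κ C : ℝ} {x : Fin n → ℝ} (hC : 0 < C) (hx : KDioWith κ C x) :
    1 ≤ κ := by
  by_contra! hκ
  have key : ∀ q : ℕ, 1 ≤ q → C < ((q : ℝ) + 1) ^ (-(1 - κ)) := by
    intro q hq
    have hq1 : (1 : ℝ) ≤ q := by exact_mod_cast hq
    have hq0 : (0 : ℝ) < q := by linarith
    have hs : (0 : ℝ) < (q : ℝ) + 1 := by linarith
    obtain ⟨i, hi⟩ := hx (1 / ((q : ℝ) + 1)) (by positivity)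
      (by rw [div_lt_one hs]; linarith) (fun i => round (x i * q)) (fun _ => (q : ℤ))
      (fun _ => by simp only [ne_eq, Nat.cast_eq_zero]; omega)
      (fun _ => by rw [one_div_one_div, Int.cast_natCast, abs_of_pos hq0]; linarith)
    have hr := abs_sub_round (x i * q)
    have heq : x i - (round (x i * q) : ℝ) / q = (x i * q - round (x i * q)) / q := by
      field_simp
    simp only [Int.cast_natCast] at hi
    rw [heq, abs_div, abs_of_pos hq0] at hi
    have h2 : |x i * q - round (x i * q)| / q ≤ 1 / ((q : ℝ) + 1) := by
      rw [div_le_div_iff₀ hq0 hs]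
      nlinarith
    have h3 : C * (1 / ((q : ℝ) + 1)) ^ κ < 1 / ((q : ℝ) + 1) := hi.trans_le h2
    rw [one_div, Real.inv_rpow hs.le, ← div_eq_mul_inv, div_lt_iff₀ (by positivity)] at h3
    rwa [← Real.rpow_neg_one, ← Real.rpow_add hs,
      show (-1 : ℝ) + κ = -(1 - κ) by ring] at h3
  have hlim : Filter.Tendsto (fun q : ℕ => ((q : ℝ) + 1) ^ (-(1 - κ))) Filter.atTop (nhds 0) :=
    (tendsto_rpow_neg_atTop (by linarith)).comp
      (Filter.tendsto_atTop_add_const_right _ 1 tendsto_natCast_atTop_atTop)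
  have hev := hlim.eventually (gt_mem_nhds hC)
  obtain ⟨q, hq, hq1⟩ := (hev.and (Filter.eventually_ge_atTop 1)).exists
  exact lt_asymm hq (key q hq1)

/-- Eliminating a variable from two approximate relations gives a rational approximation. -/
lemma abs_sub_div_lt_of_linear_combination {y L L' N ε : ℝ} {D u u' p q p' q' : ℤ}
    (hD : D ≠ 0) (hq : q ≠ 0) (hq' : q' ≠ 0) (hN : 0 < N)
    (h : (D : ℝ) * y = u * L - u' * L') (hu : |(u : ℝ)| ≤ N) (hu' : |(u' : ℝ)| ≤ N)
    (hL : |L - p / q| < ε) (hL' : |L' - p' / q'| < ε) :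
    |y - ((u * p * q' - u' * p' * q : ℤ) : ℝ) / ((D * q * q' : ℤ) : ℝ)| < 2 * N * ε := by
  have hDr : (D : ℝ) ≠ 0 := by exact_mod_cast hD
  have hqr : (q : ℝ) ≠ 0 := by exact_mod_cast hq
  have hqr' : (q' : ℝ) ≠ 0 := by exact_mod_cast hq'
  have hD1 : (1 : ℝ) ≤ |(D : ℝ)| := by exact_mod_cast Int.one_le_abs hD
  have heq : (D : ℝ) * (y - ((u * p * q' - u' * p' * q : ℤ) : ℝ) / ((D * q * q' : ℤ) : ℝ))
      = u * (L - p / q) - u' * (L' - p' / q') := by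
    rw [mul_sub, h]
    push_cast
    field_simp
    ring
  calc |y - ((u * p * q' - u' * p' * q : ℤ) : ℝ) / ((D * q * q' : ℤ) : ℝ)|
      ≤ |(D : ℝ)| * |y - ((u * p * q' - u' * p' * q : ℤ) : ℝ) / ((D * q * q' : ℤ) : ℝ)| :=
        le_mul_of_one_le_left (abs_nonneg _) hD1
    _ = |(u : ℝ) * (L - p / q) - u' * (L' - p' / q')| := by rw [← abs_mul, heq]
    _ ≤ |(u : ℝ)| * |L - p / q| + |(u' : ℝ)| * |L' - p' / q'| := by
        rw [← abs_mul, ← abs_mul]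
        exact abs_sub _ _
    _ ≤ N * |L - p / q| + N * |L' - p' / q'| := by gcongr
    _ < N * ε + N * ε := by gcongr
    _ = 2 * N * ε := by ring

/-- Proportional primitive integer pairs agree up to sign. -/
lemma IsCoprime.eq_or_eq_neg_of_mul_eq {a b a' b' : ℤ} (h : IsCoprime a b)
    (h' : IsCoprime a' b') (hD : a * b' - a' * b = 0) :
    (a' = a ∧ b' = b) ∨ (a' = -a ∧ b' = -b) := by
  have h1 : a ∣ a' := h.dvd_of_dvd_mul_right ⟨b', by linarith⟩
  have h2 : a' ∣ a := h'.dvd_of_dvd_mul_right ⟨b, by linarith⟩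
  have h3 : b ∣ b' := h.symm.dvd_of_dvd_mul_left ⟨a', by linarith⟩
  have h4 : b' ∣ b := h'.symm.dvd_of_dvd_mul_left ⟨a, by linarith⟩
  have ha := Int.natAbs_eq_natAbs_iff.1 (Nat.dvd_antisymm (Int.natAbs_dvd_natAbs.2 h2)
    (Int.natAbs_dvd_natAbs.2 h1))
  have hb := Int.natAbs_eq_natAbs_iff.1 (Nat.dvd_antisymm (Int.natAbs_dvd_natAbs.2 h4)
    (Int.natAbs_dvd_natAbs.2 h3))
  rcases ha with rfl | rfl <;> rcases hb with rfl | rfl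
  · simp
  · have : a' * b = 0 := by linarith
    rcases mul_eq_zero.1 this with rfl | rfl <;> simp
  · have : a * b' = 0 := by linarith
    rcases mul_eq_zero.1 this with rfl | rfl <;> simp
  · simp

theorem stmt_14 (x : Fin 4 → ℝ) (κ Cx : ℝ) (hκ : 0 < κ) (hCx : 0 < Cx)
    (hx : KDioWith κ Cx x) :
    ∀ τ' : ℝ, 0 < τ' → τ' ≤ 1 / (32 * κ) →
      ∃ C' T₀ : ℝ, 0 < C' ∧ 2 ≤ T₀ ∧ ∀ T : ℝ, T₀ ≤ T →
        ∀ a b a' b' : ℤ, IsCoprime a b → IsCoprime a' b' →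
          0 < Real.sqrt ((a : ℝ) ^ 2 + (b : ℝ) ^ 2) →
          Real.sqrt ((a : ℝ) ^ 2 + (b : ℝ) ^ 2) < T ^ τ' →
          0 < Real.sqrt ((a' : ℝ) ^ 2 + (b' : ℝ) ^ 2) →
          Real.sqrt ((a' : ℝ) ^ 2 + (b' : ℝ) ^ 2) < T ^ τ' →
          ApproxCond x C' T τ' κ a b → ApproxCond x C' T τ' κ a' b' →
          (a' = a ∧ b' = b) ∨ (a' = -a ∧ b' = -b) := by
  intro τ' hτ _
  have hκ1 : 1 ≤ κ := hx.one_le hCx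
  refine ⟨Cx / 2, 2, by positivity, le_rfl, ?_⟩
  intro T hT a b a' b' hab hab' _ hN _ hN'
  rintro ⟨p₁, q₁, p₂, q₂, hq₁, hq₂, hq₁N, hq₂N, h₁, h₂⟩
    ⟨p₁', q₁', p₂', q₂', hq₁', hq₂', hq₁N', hq₂N', h₁', h₂'⟩
  have hT0 : 0 < T := by linarith
  have hT1 : 1 < T := by linarith
  have hNpos : 0 < T ^ τ' := Real.rpow_pos_of_pos hT0 _
  have hN1 : 1 < T ^ τ' := Real.one_lt_rpow hT1 hτ
  refine hab.eq_or_eq_neg_of_mul_eq hab' ?_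
  by_contra hD
  have hDN : |((a * b' - a' * b : ℤ) : ℝ)| < T ^ τ' * T ^ τ' := by
    refine lt_of_le_of_lt ?_ (mul_lt_mul'' hN hN' (Real.sqrt_nonneg _) (Real.sqrt_nonneg _))
    rw [← Real.sqrt_mul (by positivity)]
    apply Real.abs_le_sqrt
    push_cast
    nlinarith [sq_nonneg ((a : ℝ) * a' + b * b')]
  have ha : |(a : ℝ)| ≤ T ^ τ' :=
    (Real.abs_le_sqrt (by nlinarith [sq_nonneg (b : ℝ)])).trans hN.le
  have hb : |(b : ℝ)| ≤ T ^ τ' :=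
    (Real.abs_le_sqrt (by nlinarith [sq_nonneg (a : ℝ)])).trans hN.le
  have ha' : |(a' : ℝ)| ≤ T ^ τ' :=
    (Real.abs_le_sqrt (by nlinarith [sq_nonneg (b' : ℝ)])).trans hN'.le
  have hb' : |(b' : ℝ)| ≤ T ^ τ' :=
    (Real.abs_le_sqrt (by nlinarith [sq_nonneg (a' : ℝ)])).trans hN'.le
  have hden : ∀ q q' : ℤ, |(q : ℝ)| < T ^ τ' → |(q' : ℝ)| < T ^ τ' →
      |(((a * b' - a' * b) * q * q' : ℤ) : ℝ)| < 1 / (1 / (T ^ τ') ^ 4) := by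
    intro q q' hq hq'
    rw [one_div_one_div, Int.cast_mul, Int.cast_mul, abs_mul, abs_mul]
    calc _ < T ^ τ' * T ^ τ' * T ^ τ' * T ^ τ' :=
          mul_lt_mul'' (mul_lt_mul'' hDN hq (abs_nonneg _) (abs_nonneg _)) hq'
            (by positivity) (abs_nonneg _)
      _ = _ := by ring
  have e0 := abs_sub_div_lt_of_linear_combination (y := x 0) (u := b') (u' := b)
    hD hq₁ hq₁' hNpos (by push_cast; ring) hb' hb h₁ h₁'
  have e1 := abs_sub_div_lt_of_linear_combination (y := x 1) (u := -b') (u' := -b)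
    hD hq₂ hq₂' hNpos (by push_cast; ring) (by simpa using hb') (by simpa using hb) h₂ h₂'
  have e2 := abs_sub_div_lt_of_linear_combination (y := x 2) (u := a') (u' := a)
    hD hq₁ hq₁' hNpos (by push_cast; ring) ha' ha h₁ h₁'
  have e3 := abs_sub_div_lt_of_linear_combination (y := x 3) (u := -a') (u' := -a)
    hD hq₂ hq₂' hNpos (by push_cast; ring) (by simpa using ha') (by simpa using ha) h₂ h₂'
  have hd₁ : (a * b' - a' * b) * q₁ * q₁' ≠ 0 := mul_ne_zero (mul_ne_zero hD hq₁) hq₁'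
  have hd₂ : (a * b' - a' * b) * q₂ * q₂' ≠ 0 := mul_ne_zero (mul_ne_zero hD hq₂) hq₂'
  have hn₁ := hden q₁ q₁' hq₁N hq₁N'
  have hn₂ := hden q₂ q₂' hq₂N hq₂N'
  obtain ⟨i, hi⟩ := hx (1 / (T ^ τ') ^ 4) (by positivity)
    (by rw [div_lt_one (by positivity)]; exact one_lt_pow₀ hN1 (by norm_num))
    ![b' * p₁ * q₁' - b * p₁' * q₁, -b' * p₂ * q₂' - -b * p₂' * q₂,
      a' * p₁ * q₁' - a * p₁' * q₁, -a' * p₂ * q₂' - -a * p₂' * q₂]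
    ![(a * b' - a' * b) * q₁ * q₁', (a * b' - a' * b) * q₂ * q₂',
      (a * b' - a' * b) * q₁ * q₁', (a * b' - a' * b) * q₂ * q₂']
    (by intro i; fin_cases i <;> assumption)
    (by intro i; fin_cases i <;> assumption)
  have hlt : Cx * (1 / (T ^ τ') ^ 4) ^ κ
      < 2 * T ^ τ' * (Cx / 2 * T ^ (-(8 * κ * τ'))) := by
    refine hi.trans ?_
    fin_cases i <;> assumption
  have hδ : (1 / (T ^ τ') ^ 4) ^ κ = T ^ (-(4 * κ * τ')) := by
    rw [one_div, ← Real.rpow_natCast, ← Real.rpow_mul hT0.le, ← Real.rpow_neg hT0.le,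
      ← Real.rpow_mul hT0.le]
    congr 1
    push_cast
    ring
  have hR : 2 * T ^ τ' * (Cx / 2 * T ^ (-(8 * κ * τ'))) = Cx * T ^ (τ' + -(8 * κ * τ')) := by
    rw [Real.rpow_add hT0]
    ring
  rw [hδ, hR, mul_lt_mul_iff_right₀ hCx, Real.rpow_lt_rpow_left_iff hT1] at hlt
  nlinarith


end
end

section
/- With the notation of the (2,2) dynamical setup, let r > 0, 0 < ε < 1, 0 < η₂ < 1, t > 0, k_θ ∈ SO(2), Λ a unimodular lattice in ℝ⁴, ζ ∈ ℝ⁴, and let L be a 2-dimensional Λ-rational subspace of the first type with T/2 ≤ ‖v^L‖ ≤ T for some T > 0. Suppose λ₀ ∈ Λ is such that |E_t^L(λ₀)| > δ^{η₂}, where E_t^L(λ₀) = {k_φ ∈ E_t^L(δ,k_θ,ε) : (L + λ₀ + ζ)_φ ∩ B(r) ≠ ∅}. Then ‖(λ₀ + ζ)_{L^⊥}‖ < 2r·δ^{1−η₂}/T, where (λ₀+ζ)_{L^⊥} is the orthogonal projection of λ₀+ζ onto the orthogonal complement of L. -/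
open MeasureTheory Filter Topology Matrix Real

noncomputable section

/-- Identify `ℝ⁴` with `M₂(ℝ)`. -/
def toMat (v : Fin 4 → ℝ) : Matrix (Fin 2) (Fin 2) ℝ := !![v 0, v 1; v 2, v 3]

def ofMat (m : Matrix (Fin 2) (Fin 2) ℝ) : Fin 4 → ℝ := ![m 0 0, m 0 1, m 1 0, m 1 1]

/-- Rotation by angle `θ`, i.e. an element of `SO(2)`. -/
def rotM (θ : ℝ) : Matrix (Fin 2) (Fin 2) ℝ :=
  !![Real.cos θ, -Real.sin θ; Real.sin θ, Real.cos θ]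

/-- `b_t = diag(e^{-t/2}, e^{t/2})`. -/
def btM (t : ℝ) : Matrix (Fin 2) (Fin 2) ℝ :=
  !![Real.exp (-(t / 2)), 0; 0, Real.exp (t / 2)]

/-- The linear map `a_t (k_θ, k_φ) : v ↦ (b_t k_θ) v (b_t k_φ)⁻¹` on `ℝ⁴ ≅ M₂(ℝ)`. -/
def act22 (t θ φ : ℝ) (v : Fin 4 → ℝ) : Fin 4 → ℝ :=
  ofMat ((btM t * rotM θ) * toMat v * (btM t * rotM φ)⁻¹)

/-- The lattice `gℤ⁴`. -/
def latt (g : Matrix (Fin 4) (Fin 4) ℝ) : Set (Fin 4 → ℝ) :=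
  {v | ∃ m : Fin 4 → ℤ, v = g *ᵥ intCast m}

/-- Coordinates of `u ∧ v ∈ ∧²ℝ⁴`, in the basis `e₀∧e₁, e₀∧e₂, e₀∧e₃, e₁∧e₂, e₁∧e₃, e₂∧e₃`. -/
def wedge (u v : Fin 4 → ℝ) : Fin 6 → ℝ :=
  ![u 0 * v 1 - u 1 * v 0, u 0 * v 2 - u 2 * v 0, u 0 * v 3 - u 3 * v 0,
    u 1 * v 2 - u 2 * v 1, u 1 * v 3 - u 3 * v 1, u 2 * v 3 - u 3 * v 2]

/-- `d(a_t(k_θ,k_φ)L) = ‖a_t(k_θ,k_φ)u₁ ∧ a_t(k_θ,k_φ)u₂‖` for an integral basis `u₁,u₂`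
of `L ∩ Λ`. -/
def dval (t θ φ : ℝ) (u₁ u₂ : Fin 4 → ℝ) : ℝ :=
  eNorm (wedge (act22 t θ φ u₁) (act22 t θ φ u₂))

/-- The set `E_t^L(δ, k_θ, ε) ⊆ SO(2)` (as a set of angles `φ`). -/
def Eset (t θ δ ε : ℝ) (u₁ u₂ : Fin 4 → ℝ) : Set ℝ :=
  {φ | δ ^ (1 + ε) < dval t θ φ u₁ u₂ ∧ dval t θ φ u₁ u₂ < δ ∧
    ∀ m k : ℤ, ¬ (m = 0 ∧ k = 0) →
      δ ^ ((1 + ε) / 2) < eNorm (act22 t θ φ ((m : ℝ) • u₁ + (k : ℝ) • u₂))}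

/-- `‖x_{L^⊥}‖`: the distance from `x` to the plane spanned by `u₁, u₂`, i.e. the norm of
the orthogonal projection of `x` onto the orthogonal complement of that plane. -/
def distSub (x u₁ u₂ : Fin 4 → ℝ) : ℝ :=
  sInf {d : ℝ | ∃ c₁ c₂ : ℝ, d = eNorm (x - c₁ • u₁ - c₂ • u₂)}

/-- The affine plane `(L + λ + ζ)_φ` meets the ball `B(r)`. -/
def Meets (t θ φ r : ℝ) (u₁ u₂ lam ζ : Fin 4 → ℝ) : Prop :=
  ∃ c₁ c₂ : ℝ, eNorm (act22 t θ φ (c₁ • u₁ + c₂ • u₂ + lam + ζ)) ≤ r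

/-- Normalized Haar measure on `SO(2)` of a set of angles. -/
def measK (S : Set ℝ) : ℝ :=
  (volume (S ∩ Set.Icc 0 (2 * π))).toReal / (2 * π)

/-- `u₁, u₂` is a `ℤ`-basis of `L ∩ Λ` for `Λ = gℤ⁴` (in particular `L = span{u₁,u₂}`
is a `2`-dimensional `Λ`-rational subspace). -/
def IsLatticeBasis2 (g : Matrix (Fin 4) (Fin 4) ℝ) (u₁ u₂ : Fin 4 → ℝ) : Prop :=
  u₁ ∈ latt g ∧ u₂ ∈ latt g ∧ LinearIndependent ℝ ![u₁, u₂] ∧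
  ∀ v ∈ latt g, v ∈ Submodule.span ℝ {u₁, u₂} →
    ∃ m k : ℤ, v = (m : ℝ) • u₁ + (k : ℝ) • u₂


/-- Projection of `∧²ℝ⁴` onto the invariant summand
`V₁ = span{e₀∧e₁, e₂∧e₃, e₀∧e₃ - e₁∧e₂}` (the summand containing the null subspaces of
the first kind). -/
def pi1 (w : Fin 6 → ℝ) : Fin 6 → ℝ :=
  ![w 0, 0, (w 2 - w 3) / 2, -((w 2 - w 3) / 2), 0, w 5]

/-- Projection of `∧²ℝ⁴` onto the invariant summand
`V₂ = span{e₀∧e₂, e₁∧e₃, e₀∧e₃ + e₁∧e₂}`. -/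
def pi2 (w : Fin 6 → ℝ) : Fin 6 → ℝ :=
  ![0, w 1, (w 2 + w 3) / 2, (w 2 + w 3) / 2, w 4, 0]

/-- The Hodge dual of `u ∧ v ∧ z`, i.e. the triple cross product in `ℝ⁴`. -/
def cross3 (u v z : Fin 4 → ℝ) : Fin 4 → ℝ :=
  ![u 1 * (v 2 * z 3 - v 3 * z 2) - u 2 * (v 1 * z 3 - v 3 * z 1) + u 3 * (v 1 * z 2 - v 2 * z 1),
    -(u 0 * (v 2 * z 3 - v 3 * z 2) - u 2 * (v 0 * z 3 - v 3 * z 0)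
      + u 3 * (v 0 * z 2 - v 2 * z 0)),
    u 0 * (v 1 * z 3 - v 3 * z 1) - u 1 * (v 0 * z 3 - v 3 * z 0) + u 3 * (v 0 * z 1 - v 1 * z 0),
    -(u 0 * (v 1 * z 2 - v 2 * z 1) - u 1 * (v 0 * z 2 - v 2 * z 0)
      + u 2 * (v 0 * z 1 - v 1 * z 0))]

/-- Left multiplication by `rotM θ` on `ℝ⁴ ≅ M₂(ℝ)`. -/
def rotLeft (θ : ℝ) (v : Fin 4 → ℝ) : Fin 4 → ℝ :=
  ![cos θ * v 0 - sin θ * v 2, cos θ * v 1 - sin θ * v 3,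
    sin θ * v 0 + cos θ * v 2, sin θ * v 1 + cos θ * v 3]

/-- Right multiplication by `(rotM φ)⁻¹` on `ℝ⁴ ≅ M₂(ℝ)`. -/
def rotRight (φ : ℝ) (v : Fin 4 → ℝ) : Fin 4 → ℝ :=
  ![cos φ * v 0 - sin φ * v 1, sin φ * v 0 + cos φ * v 1,
    cos φ * v 2 - sin φ * v 3, sin φ * v 2 + cos φ * v 3]

/-- Conjugation by `btM t` on `ℝ⁴ ≅ M₂(ℝ)`. -/
def conjDiag (t : ℝ) (v : Fin 4 → ℝ) : Fin 4 → ℝ :=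
  ![v 0, exp (-t) * v 1, exp t * v 2, v 3]

lemma eNorm_nonneg {n : ℕ} (x : Fin n → ℝ) : 0 ≤ eNorm x := Real.sqrt_nonneg _

lemma eNorm_sq {n : ℕ} (x : Fin n → ℝ) : eNorm x ^ 2 = ∑ i, x i ^ 2 :=
  Real.sq_sqrt (Finset.sum_nonneg fun _ _ => sq_nonneg _)

lemma eNorm_sq_four (x : Fin 4 → ℝ) :
    eNorm x ^ 2 = x 0 ^ 2 + x 1 ^ 2 + x 2 ^ 2 + x 3 ^ 2 := by
  rw [eNorm_sq, Fin.sum_univ_four]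

lemma eNorm_sq_wedge (u v : Fin 4 → ℝ) :
    eNorm (wedge u v) ^ 2 = (u ⬝ᵥ u) * (v ⬝ᵥ v) - (u ⬝ᵥ v) ^ 2 := by
  rw [eNorm_sq]
  simp only [wedge, Fin.sum_univ_six, dotProduct, Fin.sum_univ_four]
  simp
  ring

lemma inv_btM_mul_rotM (t φ : ℝ) :
    (btM t * rotM φ)⁻¹ = !![cos φ * exp (t / 2), sin φ * exp (-(t / 2));
      -sin φ * exp (t / 2), cos φ * exp (-(t / 2))] := by
  have h : exp (-(t / 2)) * exp (t / 2) = 1 := by rw [← exp_add]; simp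
  have hc := sin_sq_add_cos_sq φ
  apply Matrix.inv_eq_right_inv
  ext i j
  fin_cases i <;> fin_cases j <;>
    simp [btM, rotM, Matrix.mul_apply, Fin.sum_univ_two]
  · linear_combination (cos φ ^ 2 + sin φ ^ 2) * h + hc
  · ring
  · ring
  · linear_combination (cos φ ^ 2 + sin φ ^ 2) * h + hc

lemma act22_eq (t θ φ : ℝ) (v : Fin 4 → ℝ) :
    act22 t θ φ v = conjDiag t (rotRight φ (rotLeft θ v)) := by
  have h : exp (-(t / 2)) * exp (t / 2) = 1 := by rw [← exp_add]; simp
  have h1 : exp (-t) = exp (-(t / 2)) * exp (-(t / 2)) := by rw [← exp_add]; ring_nf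
  have h2 : exp t = exp (t / 2) * exp (t / 2) := by rw [← exp_add]; ring_nf
  rw [act22, inv_btM_mul_rotM, conjDiag, h1, h2]
  ext i
  fin_cases i <;>
    simp [btM, rotM, ofMat, toMat, Matrix.mul_apply, Fin.sum_univ_two, rotRight, rotLeft]
  · linear_combination (cos φ * (cos θ * v 0 - sin θ * v 2)
      - sin φ * (cos θ * v 1 - sin θ * v 3)) * h
  · ring
  · ring
  · linear_combination (sin φ * (sin θ * v 0 + cos θ * v 2)
      + cos φ * (sin θ * v 1 + cos θ * v 3)) * h

lemma cross3_rotLeft (θ : ℝ) (u v z : Fin 4 → ℝ) :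
    cross3 (rotLeft θ u) (rotLeft θ v) (rotLeft θ z) = rotLeft θ (cross3 u v z) := by
  have hc : sin θ ^ 2 = 1 - cos θ ^ 2 := sin_sq θ
  have hc3 : sin θ ^ 3 = sin θ * (1 - cos θ ^ 2) := by rw [← hc]; ring
  ext i
  fin_cases i <;> simp [cross3, rotLeft] <;> ring_nf <;> simp only [hc, hc3] <;> ring

lemma cross3_rotRight (φ : ℝ) (u v z : Fin 4 → ℝ) :
    cross3 (rotRight φ u) (rotRight φ v) (rotRight φ z) = rotRight φ (cross3 u v z) := by
  have hc : sin φ ^ 2 = 1 - cos φ ^ 2 := sin_sq φ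
  have hc3 : sin φ ^ 3 = sin φ * (1 - cos φ ^ 2) := by rw [← hc]; ring
  ext i
  fin_cases i <;> simp [cross3, rotRight] <;> ring_nf <;> simp only [hc, hc3] <;> ring

lemma cross3_conjDiag (t : ℝ) (u v z : Fin 4 → ℝ) :
    cross3 (conjDiag t u) (conjDiag t v) (conjDiag t z) = conjDiag (-t) (cross3 u v z) := by
  have h : exp (-t) * exp t = 1 := by rw [← exp_add]; simp
  ext i
  fin_cases i <;> simp [cross3, conjDiag]
  · linear_combination (u 1 * (v 2 * z 3 - v 3 * z 2) - u 2 * (v 1 * z 3 - v 3 * z 1)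
      + u 3 * (v 1 * z 2 - v 2 * z 1)) * h
  · ring
  · ring
  · linear_combination -(u 0 * (v 1 * z 2 - v 2 * z 1) - u 1 * (v 0 * z 2 - v 2 * z 0)
      + u 2 * (v 0 * z 1 - v 1 * z 0)) * h

lemma cross3_act22 (t θ φ : ℝ) (u v z : Fin 4 → ℝ) :
    cross3 (act22 t θ φ u) (act22 t θ φ v) (act22 t θ φ z) =
      act22 (-t) θ φ (cross3 u v z) := by
  simp only [act22_eq, cross3_conjDiag, cross3_rotRight, cross3_rotLeft]

lemma cross3_add_span (u v z : Fin 4 → ℝ) (a b c : ℝ) :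
    cross3 u v (a • z + b • u + c • v) = a • cross3 u v z := by
  ext i
  fin_cases i <;> simp [cross3] <;> ring

lemma eNorm_sq_cross3 (u v z : Fin 4 → ℝ) :
    eNorm (cross3 u v z) ^ 2 = eNorm (wedge u v) ^ 2 * eNorm z ^ 2 -
      eNorm ((v ⬝ᵥ z) • u - (u ⬝ᵥ z) • v) ^ 2 := by
  rw [eNorm_sq_wedge]
  simp only [eNorm_sq_four, dotProduct, Fin.sum_univ_four]
  simp [cross3]
  ring

lemma eNorm_cross3_le (u v z : Fin 4 → ℝ) :
    eNorm (cross3 u v z) ≤ eNorm (wedge u v) * eNorm z := by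
  refine le_of_sq_le_sq ?_ (mul_nonneg (eNorm_nonneg _) (eNorm_nonneg _))
  rw [mul_pow, eNorm_sq_cross3]
  linarith [sq_nonneg (eNorm ((v ⬝ᵥ z) • u - (u ⬝ᵥ z) • v))]

lemma eNorm_wedge_mul_distSub_le (x u v : Fin 4 → ℝ) :
    eNorm (wedge u v) * distSub x u v ≤ eNorm (cross3 u v x) := by
  rcases (eNorm_nonneg (wedge u v)).eq_or_lt with h0 | h0
  · rw [← h0, zero_mul]
    exact eNorm_nonneg _
  have hG : eNorm (wedge u v) ^ 2 ≠ 0 := by positivity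
  set G := eNorm (wedge u v) ^ 2 with hGdef
  set a := ((u ⬝ᵥ x) * (v ⬝ᵥ v) - (v ⬝ᵥ x) * (u ⬝ᵥ v)) / G with ha
  set b := ((v ⬝ᵥ x) * (u ⬝ᵥ u) - (u ⬝ᵥ x) * (u ⬝ᵥ v)) / G with hb
  have hG' := eNorm_sq_wedge u v
  rw [← hGdef] at hG'
  set y := x - a • u - b • v with hy
  have hyu : u ⬝ᵥ y = 0 := by
    simp only [hy, dotProduct_sub, dotProduct_smul, smul_eq_mul]
    rw [ha, hb]
    field_simp
    rw [hG']
    ring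
  have hyv : v ⬝ᵥ y = 0 := by
    simp only [hy, dotProduct_sub, dotProduct_smul, smul_eq_mul, dotProduct_comm v u]
    rw [ha, hb]
    field_simp
    rw [hG']
    ring
  have hcross : cross3 u v y = cross3 u v x := by
    have := cross3_add_span u v x 1 (-a) (-b)
    rw [one_smul, one_smul] at this
    rw [← this, hy]
    congr 1
    module
  have hle : distSub x u v ≤ eNorm y :=
    csInf_le ⟨0, by rintro _ ⟨_, _, rfl⟩; exact eNorm_nonneg _⟩ ⟨a, b, rfl⟩
  refine (mul_le_mul_of_nonneg_left hle h0.le).trans ?_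
  refine le_of_sq_le_sq ?_ (eNorm_nonneg _)
  rw [← hcross, eNorm_sq_cross3, hyu, hyv, mul_pow]
  simp [eNorm]

lemma eNorm_sq_rotLeft (θ : ℝ) (v : Fin 4 → ℝ) : eNorm (rotLeft θ v) ^ 2 = eNorm v ^ 2 := by
  simp only [eNorm_sq_four]
  simp [rotLeft]
  linear_combination (v 0 ^ 2 + v 1 ^ 2 + v 2 ^ 2 + v 3 ^ 2) * sin_sq_add_cos_sq θ

lemma sq_add_sq_le_eNorm_sq_act22_neg {t : ℝ} (ht : 0 ≤ t) (θ φ : ℝ) (w : Fin 4 → ℝ) :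
    rotLeft θ w 0 ^ 2 + rotLeft θ w 1 ^ 2 +
      (sin φ * rotLeft θ w 2 + cos φ * rotLeft θ w 3) ^ 2 ≤ eNorm (act22 (-t) θ φ w) ^ 2 := by
  rw [act22_eq, eNorm_sq_four]
  generalize rotLeft θ w = m
  have h1 : 1 ≤ exp t ^ 2 := one_le_pow₀ (one_le_exp ht)
  have h2 := mul_le_mul_of_nonneg_right h1 (sq_nonneg (sin φ * m 0 + cos φ * m 1))
  have h3 : (cos φ * m 0 - sin φ * m 1) ^ 2 + (sin φ * m 0 + cos φ * m 1) ^ 2 =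
      m 0 ^ 2 + m 1 ^ 2 := by
    linear_combination (m 0 ^ 2 + m 1 ^ 2) * sin_sq_add_cos_sq φ
  simp only [conjDiag, rotRight]
  simp only [neg_neg, cons_val, mul_pow (exp t)]
  linarith [sq_nonneg (exp (-t) * (cos φ * m 2 - sin φ * m 3))]

lemma exists_sin_sub (a b : ℝ) :
    ∃ α : ℝ, ∀ φ : ℝ, (sin φ * a + cos φ * b) ^ 2 = (a ^ 2 + b ^ 2) * sin (φ - α) ^ 2 := by
  refine ⟨Complex.arg ⟨a, -b⟩, fun φ => ?_⟩
  have h1 := Complex.norm_mul_cos_arg ⟨a, -b⟩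
  have h2 := Complex.norm_mul_sin_arg ⟨a, -b⟩
  have h3 : ‖(⟨a, -b⟩ : ℂ)‖ ^ 2 = a ^ 2 + b ^ 2 := by
    rw [Complex.sq_norm, Complex.normSq_mk]; ring
  simp only at h1 h2
  rw [← h3, ← mul_pow, sin_sub]
  congr 1
  linear_combination -sin φ * h1 + cos φ * h2

lemma abs_lt_of_abs_sin_lt {p x : ℝ} (hx : |x| ≤ π / 2) (h : |sin x| < p) :
    |x| < p * π / 2 := by
  have := mul_abs_le_abs_sin hx
  have hp := this.trans_lt h
  rw [div_mul_eq_mul_div, div_lt_iff₀ pi_pos] at hp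
  linarith

/-- The set of angles in one period with `|sin| < p` has normalized measure at most `p`. -/
lemma measK_abs_sin_sub_lt_le {p : ℝ} (hp : 0 ≤ p) (α : ℝ) :
    measK {φ | |sin (φ - α)| < p} ≤ p := by
  set S : Set ℝ := {φ | |sin (φ - α)| < p} with hS
  have hSm : MeasurableSet S := (isOpen_lt (by fun_prop) continuous_const).measurableSet
  have hper : Function.Periodic (S.indicator (fun _ => (1 : ℝ))) (2 * π) := by
    intro x
    have : x + 2 * π ∈ S ↔ x ∈ S := by
      simp only [hS, Set.mem_ofPred_eq]
      rw [show x + 2 * π - α = x - α + 2 * π by ring, sin_add_two_pi]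
    by_cases hx : x ∈ S
    · rw [Set.indicator_of_mem hx, Set.indicator_of_mem (this.2 hx)]
    · rw [Set.indicator_of_notMem hx, Set.indicator_of_notMem (mt this.1 hx)]
  have hint : ∀ a : ℝ, ∫ x in a..(a + 2 * π), S.indicator (fun _ => (1 : ℝ)) x =
      (volume (S ∩ Set.Icc a (a + 2 * π))).toReal := by
    intro a
    rw [intervalIntegral.integral_of_le (by linarith [pi_pos]), ← integral_Icc_eq_integral_Ioc,
      integral_indicator hSm, Measure.restrict_restrict hSm]
    simp [Measure.real]
  have hshift := hper.intervalIntegral_add_eq 0 (α - π / 2)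
  rw [hint, hint, zero_add] at hshift
  rw [measK, hshift, div_le_iff₀ (by positivity)]
  have hsub : S ∩ Set.Icc (α - π / 2) (α - π / 2 + 2 * π) ⊆
      Set.Ioo (α - p * π / 2) (α + p * π / 2) ∪
        Set.Ioo (α + π - p * π / 2) (α + π + p * π / 2) := by
    rintro x ⟨hx, hx1, hx2⟩
    simp only [hS, Set.mem_ofPred_eq] at hx
    rcases le_total x (α + π / 2) with h | h
    · left
      have := abs_lt.1 (abs_lt_of_abs_sin_lt (abs_le.2 ⟨by linarith, by linarith⟩) hx)
      exact ⟨by linarith [this.1], by linarith [this.2]⟩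
    · right
      rw [← abs_neg, ← sin_sub_pi] at hx
      have := abs_lt.1 (abs_lt_of_abs_sin_lt (abs_le.2 ⟨by linarith, by linarith⟩) hx)
      exact ⟨by linarith [this.1], by linarith [this.2]⟩
  have hpp : 0 ≤ p * π := mul_nonneg hp pi_pos.le
  refine ENNReal.toReal_le_of_le_ofReal (by nlinarith) ?_
  refine (measure_mono hsub).trans ((measure_union_le _ _).trans ?_)
  rw [Real.volume_Ioo, Real.volume_Ioo, ← ENNReal.ofReal_add (by linarith) (by linarith)]
  exact ENNReal.ofReal_le_ofReal (by linarith)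

lemma measK_mono {S S' : Set ℝ} (h : S ⊆ S') : measK S ≤ measK S' := by
  unfold measK
  have hfin : volume (S' ∩ Set.Icc 0 (2 * π)) ≠ ⊤ :=
    measure_ne_top_of_subset Set.inter_subset_right measure_Icc_lt_top.ne
  gcongr

lemma eNorm_act22_cross3_le {t θ φ r : ℝ} {u v lam ζ : Fin 4 → ℝ}
    (h : Meets t θ φ r u v lam ζ) :
    eNorm (act22 (-t) θ φ (cross3 u v (lam + ζ))) ≤ dval t θ φ u v * r := by
  obtain ⟨a, b, hab⟩ := h
  have hx := cross3_add_span u v (lam + ζ) 1 a b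
  rw [one_smul, one_smul, show lam + ζ + a • u + b • v = a • u + b • v + lam + ζ by abel] at hx
  rw [← hx, ← cross3_act22]
  exact (eNorm_cross3_le _ _ _).trans (mul_le_mul_of_nonneg_left hab (eNorm_nonneg _))

/-- If `a_{-t}(k_θ,k_φ)` sends `w` to norm below `ρ` for a set of `φ` of measure more
than `p`, then `w` itself has norm less than `ρ / p`. -/
lemma mul_eNorm_lt_of_lt_measK {t θ ρ p : ℝ} (ht : 0 ≤ t) (hρ : 0 ≤ ρ) (hp : 0 ≤ p) (hp1 : p ≤ 1)
    (w : Fin 4 → ℝ) {S : Set ℝ} (hS : ∀ φ ∈ S, eNorm (act22 (-t) θ φ w) < ρ)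
    (hpS : p < measK S) : p * eNorm w < ρ := by
  by_contra! hcon
  obtain ⟨α, hα⟩ := exists_sin_sub (rotLeft θ w 2) (rotLeft θ w 3)
  refine absurd hpS (not_lt.2 ((measK_mono fun φ hφ => ?_).trans (measK_abs_sin_sub_lt_le hp α)))
  have h1 := sq_add_sq_le_eNorm_sq_act22_neg ht θ φ w
  have h2 := pow_lt_pow_left₀ (hS φ hφ) (eNorm_nonneg _) two_ne_zero
  have h3 := pow_le_pow_left₀ hρ hcon 2
  rw [mul_pow, ← eNorm_sq_rotLeft θ, eNorm_sq_four] at h3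
  rw [hα] at h1
  rw [Set.mem_ofPred_eq, ← abs_of_nonneg hp, ← sq_lt_sq]
  by_contra! h4
  have hp2 : p ^ 2 ≤ 1 := pow_le_one₀ hp hp1
  generalize rotLeft θ w = m at *
  nlinarith [mul_le_mul_of_nonneg_left h4 (add_nonneg (sq_nonneg (m 2)) (sq_nonneg (m 3))),
    mul_le_mul_of_nonneg_right hp2 (add_nonneg (sq_nonneg (m 0)) (sq_nonneg (m 1)))]

theorem stmt_16 (r ε η₂ δ t θ T μ₁ C₀ : ℝ)
    (hr : 0 < r) (hε : 0 < ε) (hε1 : ε < 1) (hη₂ : 0 < η₂) (hη₂1 : η₂ < 1)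
    (hδ : 0 < δ) (hδ1 : δ < 1) (ht : 0 < t) (hT : 0 < T)
    (hμ₁ : 0 < μ₁) (hμ₁1 : μ₁ < 1) (hC₀ : 0 < C₀)
    (g : Matrix (Fin 4) (Fin 4) ℝ) (hg : |g.det| = 1)
    (ζ : Fin 4 → ℝ) (u₁ u₂ : Fin 4 → ℝ) (hL : IsLatticeBasis2 g u₁ u₂)
    -- `T/2 ≤ ‖v^L‖ ≤ T`
    (hvL : T / 2 ≤ eNorm (wedge u₁ u₂) ∧ eNorm (wedge u₁ u₂) ≤ T)
    -- `L` is `μ₁`-quasinull ...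
    (hquasi : eNorm (pi1 (wedge u₁ u₂)) * eNorm (pi2 (wedge u₁ u₂)) < μ₁)
    -- ... of the first type
    (htype : eNorm (pi2 (wedge u₁ u₂)) ≤ eNorm (pi1 (wedge u₁ u₂)))
    (htype' : eNorm (pi2 (wedge u₁ u₂)) < C₀ / T)
    (lam₀ : Fin 4 → ℝ) (hlam₀ : lam₀ ∈ latt g)
    -- `|E_t^L(λ₀)| > δ^{η₂}`
    (hE : δ ^ η₂ <
      measK {φ | φ ∈ Eset t θ δ ε u₁ u₂ ∧ Meets t θ φ r u₁ u₂ lam₀ ζ}) :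
    distSub (lam₀ + ζ) u₁ u₂ < 2 * r * δ ^ (1 - η₂) / T := by
  have hp : 0 < δ ^ η₂ := rpow_pos_of_pos hδ _
  have key : δ ^ η₂ * eNorm (cross3 u₁ u₂ (lam₀ + ζ)) < δ * r := by
    refine mul_eNorm_lt_of_lt_measK (θ := θ) ht.le (mul_pos hδ hr).le hp.le
      (rpow_le_one hδ.le hδ1.le hη₂.le) _ (fun φ hφ => ?_) hE
    exact (eNorm_act22_cross3_le hφ.2).trans_lt (mul_lt_mul_of_pos_right hφ.1.2.1 hr)
  have hdist : 0 ≤ distSub (lam₀ + ζ) u₁ u₂ :=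
    Real.sInf_nonneg (by rintro _ ⟨_, _, rfl⟩; exact eNorm_nonneg _)
  have hle := (mul_le_mul_of_nonneg_right hvL.1 hdist).trans
    (eNorm_wedge_mul_distSub_le (lam₀ + ζ) u₁ u₂)
  rw [rpow_sub hδ, rpow_one, lt_div_iff₀ hT, ← mul_div_assoc, lt_div_iff₀ hp]
  linarith [mul_le_mul_of_nonneg_left hle hp.le]

end
end
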